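/- arXiv:2210.13203 — 3 statements merged into one kernel-verified Lean document; each statement's English description precedes it below -/
import Mathlib

section
/- Let α be an action of a countable group Γ by homeomorphisms on a compact Hausdorff 0-dimensional space X. Then T(α) is almost unperforated (for all a,b ∈ T(α) and n ∈ ℕ, (n+1)a ≤ nb implies a ≤ b) if and only if for all a, b ∈ T(α): if a ≤ kb for some k ∈ ℕ and μ(a) < 1 for every state μ ∈ M_∞(α) with μ(b) = 1, then a ≤ b. -/
open MeasureTheory Set
open scoped ENNReal

/-! Preliminary definitions: the clopen type semigroup of an action of a group `Γ`
by homeomorphisms on a topological space `X`, invariant measures, dynamical comparison,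
topological full groups, and the topology on spaces of actions. -/

/-- The group of self-homeomorphisms of `X`, with `(g * h) x = g (h x)`. -/
instance homeoGroup (X : Type*) [TopologicalSpace X] : Group (X ≃ₜ X) where
  mul g h := h.trans g
  one := Homeomorph.refl X
  inv := Homeomorph.symm
  mul_assoc a b c := Homeomorph.ext fun _ => rfl
  one_mul a := Homeomorph.ext fun _ => rfl
  mul_one a := Homeomorph.ext fun _ => rfl
  inv_mul_cancel a := Homeomorph.ext fun x => a.symm_apply_apply x

/-- The Cantor space `{0,1}^ℕ`. -/
abbrev Cantor : Type := ℕ → Bool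

section Defs

variable {Γ : Type*} [Group Γ] {X : Type*} [TopologicalSpace X]

/-- A left-invariant finitely additive probability measure on (the power set of) `Γ`,
with values in `[0,1]`. `Γ` is amenable iff such a measure exists. -/
def IsInvFapm {Γ : Type*} [Group Γ] (m : Set Γ → ℝ) : Prop :=
  (∀ E : Set Γ, 0 ≤ m E) ∧ (∀ E : Set Γ, m E ≤ 1) ∧ m Set.univ = 1 ∧
  (∀ E F : Set Γ, Disjoint E F → m (E ∪ F) = m E + m F) ∧
  (∀ (γ : Γ) (E : Set Γ), m ((γ * ·) '' E) = m E)

/-- The action of `γ ∈ Γ` on continuous `ℕ`-valued functions: `(γ · f)(x) = f(γ⁻¹ · x)`. -/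
def actC (α : Γ →* X ≃ₜ X) (γ : Γ) (f : C(X, ℕ)) : C(X, ℕ) :=
  f.comp (α γ⁻¹)

/-- The equidecomposability relation `∼` on `C(X, ℕ)`: `f ∼ g` iff `f = h₁ + ⋯ + hₙ`
and `g = γ₁·h₁ + ⋯ + γₙ·hₙ` for some `hᵢ ∈ C(X,ℕ)`, `γᵢ ∈ Γ`. -/
def TypeRel (α : Γ →* X ≃ₜ X) (f g : C(X, ℕ)) : Prop :=
  ∃ (n : ℕ) (h : Fin n → C(X, ℕ)) (γ : Fin n → Γ),
    f = ∑ i, h i ∧ g = ∑ i, actC α (γ i) (h i)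

/-- The additive congruence on `C(X, ℕ)` generated by `∼` (since `∼` is itself an
additive congruence, this is just `∼`). -/
def typeCon (α : Γ →* X ≃ₜ X) : AddCon C(X, ℕ) := addConGen (TypeRel α)

/-- The clopen type semigroup `T(α) = C(X,ℕ)/∼`. -/
abbrev TypeSemigroup (α : Γ →* X ≃ₜ X) := (typeCon α).Quotient

/-- The class `[f] ∈ T(α)` of `f ∈ C(X, ℕ)`. -/
def cls (α : Γ →* X ≃ₜ X) (f : C(X, ℕ)) : TypeSemigroup α := (typeCon α).toQuotient f

/-- The algebraic preorder on `T(α)`: `a ≤ b` iff `a + c = b` for some `c`. -/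
def tle (α : Γ →* X ≃ₜ X) (a b : TypeSemigroup α) : Prop := ∃ c, a + c = b

/-- `T(α)` is unperforated: `n • a ≤ n • b` implies `a ≤ b` for all `n ≥ 1`. -/
def IsUnperforated (α : Γ →* X ≃ₜ X) : Prop :=
  ∀ (a b : TypeSemigroup α) (n : ℕ), 1 ≤ n → tle α (n • a) (n • b) → tle α a b

/-- `T(α)` is almost unperforated: `(n+1) • a ≤ n • b` implies `a ≤ b`. -/
def IsAlmostUnperforated (α : Γ →* X ≃ₜ X) : Prop :=
  ∀ (a b : TypeSemigroup α) (n : ℕ), tle α ((n + 1) • a) (n • b) → tle α a b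

/-- `T(α)` is cancellative: `a + b = a + c` implies `b = c`. -/
def IsCancellative (α : Γ →* X ≃ₜ X) : Prop :=
  ∀ a b c : TypeSemigroup α, a + b = a + c → b = c

/-- The algebraic preorder on `T(α)` is a partial order, i.e. it is antisymmetric. -/
def TleAntisymm (α : Γ →* X ≃ₜ X) : Prop :=
  ∀ a b : TypeSemigroup α, tle α a b → tle α b a → a = b

/-- `b` is an order unit of `T(α)`: every `a` satisfies `a ≤ k • b` for some `k ∈ ℕ`. -/
def IsOrderUnit (α : Γ →* X ≃ₜ X) (b : TypeSemigroup α) : Prop :=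
  ∀ a : TypeSemigroup α, ∃ k : ℕ, tle α a (k • b)

/-- A state on `T(α)`: an additive map to `[0,∞]` sending `0` to `0`. -/
def IsState (α : Γ →* X ≃ₜ X) (ν : TypeSemigroup α → ℝ≥0∞) : Prop :=
  ν 0 = 0 ∧ ∀ a b : TypeSemigroup α, ν (a + b) = ν a + ν b

/-- `M(α)`: the set of `Γ`-invariant Radon (regular Borel) probability measures on `X`. -/
def invRadon (α : Γ →* X ≃ₜ X) : Set (@Measure X (borel X)) :=
  letI : MeasurableSpace X := borel X
  {μ : Measure X | IsProbabilityMeasure μ ∧ μ.Regular ∧ ∀ γ : Γ, Measure.map ⇑(α γ) μ = μ}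

/-- The set of `Γ`-invariant Borel probability measures on `X`. -/
def invBorel (α : Γ →* X ≃ₜ X) : Set (@Measure X (borel X)) :=
  letI : MeasurableSpace X := borel X
  {μ : Measure X | IsProbabilityMeasure μ ∧ ∀ γ : Γ, Measure.map ⇑(α γ) μ = μ}

/-- `μ([f]) = ∫ f dμ`, the value of (the state associated with) a measure on the class of
`f ∈ C(X, ℕ)`. -/
noncomputable def intOf {X : Type*} [TopologicalSpace X] (μ : @Measure X (borel X))
    (f : C(X, ℕ)) : ℝ :=
  letI : MeasurableSpace X := borel X
  ∫ x, (f x : ℝ) ∂μ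

/-- `A` is subequidecomposable to `B`: there are a partition `A = A₁ ⊔ ⋯ ⊔ Aₙ` into clopen
sets and `γ₁, …, γₙ ∈ Γ` with `γ₁A₁, …, γₙAₙ` pairwise disjoint and contained in `B`. -/
def Subequidecomposable (α : Γ →* X ≃ₜ X) (A B : Set X) : Prop :=
  ∃ (n : ℕ) (P : Fin n → Set X) (γ : Fin n → Γ),
    (∀ i, IsClopen (P i)) ∧ (Pairwise fun i j => Disjoint (P i) (P j)) ∧
    (⋃ i, P i) = A ∧
    (Pairwise fun i j => Disjoint (⇑(α (γ i)) '' P i) (⇑(α (γ j)) '' P j)) ∧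
    ∀ i, ⇑(α (γ i)) '' P i ⊆ B

/-- Dynamical comparison (with respect to invariant Radon probability measures): for all
clopen `A`, `B` with `B` nonempty and `μ(A) < μ(B)` for every `μ ∈ M(α)`, `A` is
subequidecomposable to `B`. -/
def DynComparison (α : Γ →* X ≃ₜ X) : Prop :=
  ∀ A B : Set X, IsClopen A → IsClopen B → B.Nonempty →
    (∀ μ ∈ invRadon α, μ A < μ B) → Subequidecomposable α A B

/-- Dynamical comparison (with respect to invariant Borel probability measures). -/
def DynComparisonBorel (α : Γ →* X ≃ₜ X) : Prop :=
  ∀ A B : Set X, IsClopen A → IsClopen B → B.Nonempty →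
    (∀ μ ∈ invBorel α, μ A < μ B) → Subequidecomposable α A B

/-- The action `α` is minimal: the only closed invariant subsets are `∅` and `X`. -/
def IsMinimalAction (α : Γ →* X ≃ₜ X) : Prop :=
  ∀ F : Set X, IsClosed F → (∀ γ : Γ, ⇑(α γ) '' F ⊆ F) → F = ∅ ∨ F = Set.univ

/-- Membership in the topological full group `⟦α⟧`: `g` coincides with elements of the
action on the pieces of a finite clopen partition of `X`. -/
def InTopFullGroup (α : Γ →* X ≃ₜ X) (g : X ≃ₜ X) : Prop :=
  ∃ (n : ℕ) (P : Fin n → Set X) (γ : Fin n → Γ),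
    (∀ i, IsClopen (P i)) ∧ (Pairwise fun i j => Disjoint (P i) (P j)) ∧
    (⋃ i, P i) = Set.univ ∧ ∀ i, ∀ x ∈ P i, g x = α (γ i) x

/-- `⟦α⟧` admits a dense locally finite subgroup: there is a subgroup `Λ` of `Homeo(X)`
contained in `⟦α⟧`, locally finite (all its finitely generated subgroups are finite), and
dense in `⟦α⟧` for the topology whose basic neighborhoods of `h` are
`{g : g A = h A for all A ∈ 𝒜}`, `𝒜` ranging over finite clopen partitions of `X`. -/
def HasDenseLocallyFiniteSubgroup (α : Γ →* X ≃ₜ X) : Prop :=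
  ∃ Λ : Subgroup (X ≃ₜ X),
    ((Λ : Set (X ≃ₜ X)) ⊆ {g | InTopFullGroup α g}) ∧
    (∀ s : Finset (X ≃ₜ X), (s : Set (X ≃ₜ X)) ⊆ (Λ : Set (X ≃ₜ X)) →
      ((Subgroup.closure (s : Set (X ≃ₜ X)) : Subgroup (X ≃ₜ X)) : Set (X ≃ₜ X)).Finite) ∧
    ∀ g : X ≃ₜ X, InTopFullGroup α g →
      ∀ (n : ℕ) (P : Fin n → Set X), (∀ i, IsClopen (P i)) →
        (Pairwise fun i j => Disjoint (P i) (P j)) → (⋃ i, P i) = Set.univ →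
        ∃ l ∈ Λ, ∀ i, ⇑l '' P i = ⇑g '' P i

end Defs

/-- The topology on `Homeo(X)` whose basic neighborhoods of `h` are the sets
`{g : g A = h A for all A ∈ 𝒜}`, for `𝒜` a finite clopen partition of `X`; equivalently,
the topology generated by the sets `{g : g '' A = B}` for `A`, `B` clopen. -/
def homeoTop (X : Type*) [TopologicalSpace X] : TopologicalSpace (X ≃ₜ X) :=
  TopologicalSpace.generateFrom
    {U | ∃ A B : Set X, IsClopen A ∧ IsClopen B ∧ U = {g : X ≃ₜ X | ⇑g '' A = B}}

/-- The topology on the space `A(Γ)` of actions of `Γ` on `X`, induced from the product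
topology on `Homeo(X)^Γ`. -/
def actionTop (Γ : Type*) [Group Γ] (X : Type*) [TopologicalSpace X] :
    TopologicalSpace (Γ →* (X ≃ₜ X)) :=
  letI := homeoTop X
  TopologicalSpace.induced (fun φ : Γ →* (X ≃ₜ X) => ⇑φ) Pi.topologicalSpace

namespace AUState

/-- admissible preorders on `M` -/
structure Good {M : Type*} [AddCommMonoid M] (b : M) (R : Set (M × M)) : Prop where
  rfl' : ∀ x, (x, x) ∈ R
  trans' : ∀ x y z, (x, y) ∈ R → (y, z) ∈ R → (x, z) ∈ R
  add_right' : ∀ x y c, (x, y) ∈ R → (x + c, y + c) ∈ R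
  zero' : ∀ x, (0, x) ∈ R
  nb : ∀ n : ℕ, ((n + 1) • b, n • b) ∉ R

variable {M : Type*} [AddCommMonoid M] {b : M} {R : Set (M × M)}

theorem Good.add (h : Good b R) {x y z w : M} (h1 : (x, y) ∈ R) (h2 : (z, w) ∈ R) :
    (x + z, y + w) ∈ R := by
  refine h.trans' _ (y + z) _ (h.add_right' _ _ _ h1) ?_
  rw [add_comm y z, add_comm y w]
  exact h.add_right' _ _ _ h2

theorem Good.smul (h : Good b R) {x y : M} (h1 : (x, y) ∈ R) (n : ℕ) :
    (n • x, n • y) ∈ R := by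
  induction n with
  | zero => simpa using h.rfl' 0
  | succ k ih => rw [succ_nsmul, succ_nsmul]; exact h.add ih h1

theorem Good.le_add (h : Good b R) (x y : M) : (x, x + y) ∈ R := by
  have := h.add (h.rfl' x) (h.zero' y)
  rwa [add_zero] at this

theorem Good.mono (h : Good b R) {p q : ℕ} (x : M) (hpq : p ≤ q) : (p • x, q • x) ∈ R := by
  obtain ⟨k, rfl⟩ := Nat.exists_eq_add_of_le hpq
  rw [add_nsmul]; exact h.le_add _ _

theorem Good.le_of (h : Good b R) {p q : ℕ} (hpq : (q • b, p • b) ∈ R) : q ≤ p := by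
  by_contra hc
  exact h.nb p (h.trans' _ _ _ (h.mono b (by omega)) hpq)

/-- iterate `c + u ≤ u` -/
theorem iter (h : ∀ x y z : M, (x, y) ∈ R → (y, z) ∈ R → (x, z) ∈ R)
    (h0 : ∀ x, (x, x) ∈ R)
    (ha : ∀ x y c, (x, y) ∈ R → (x + c, y + c) ∈ R)
    {c d u : M} (hc : (u + c, u + d) ∈ R) (j : ℕ) : (u + j • c, u + j • d) ∈ R := by
  induction j with
  | zero => simpa using h0 u
  | succ k ih =>
    have h1 := ha _ _ c ih
    have h2 := ha _ _ (k • d) hc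
    have e1 : u + (k + 1) • c = u + k • c + c := by module
    have e2 : u + (k + 1) • d = u + d + k • d := by module
    have e3 : u + c + k • d = u + k • d + c := by module
    rw [e1, e2]
    rw [e3] at h2
    exact h _ _ _ h1 h2

/-- adjoin `x ≤ y` -/
def adj (R : Set (M × M)) (x y : M) : Set (M × M) :=
  {p | ∃ m : ℕ, (p.1 + m • y, p.2 + m • x) ∈ R}

theorem Good.exists_bad (h : Good b R) (hmax : ∀ S, Good b S → R ⊆ S → S ⊆ R) {x y : M}
    (hxy : (x, y) ∉ R) : ∃ m n : ℕ, ((n + 1) • b + m • y, n • b + m • x) ∈ R := by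
  by_contra hc
  push Not at hc
  have hsub : R ⊆ adj R x y := fun p hp => ⟨0, by simpa using hp⟩
  have hg : Good b (adj R x y) := by
    refine ⟨fun z => hsub (h.rfl' z), ?_, ?_, fun z => hsub (h.zero' z), ?_⟩
    · rintro u v w ⟨m, hm⟩ ⟨l, hl⟩
      refine ⟨m + l, ?_⟩
      simp only at hm hl ⊢
      have h1 := h.add_right' _ _ (l • y) hm
      have h2 := h.add_right' _ _ (m • x) hl
      have e1 : u + (m + l) • y = u + m • y + l • y := by module
      have e2 : w + (m + l) • x = w + l • x + m • x := by module
      have e3 : v + l • y + m • x = v + m • x + l • y := by module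
      rw [e1, e2]; rw [e3] at h2
      exact h.trans' _ _ _ h1 h2
    · rintro u v c ⟨m, hm⟩
      refine ⟨m, ?_⟩
      simp only at hm ⊢
      rw [add_right_comm u, add_right_comm v]
      exact h.add_right' _ _ c hm
    · rintro n ⟨m, hm⟩
      exact hc m n hm
  apply hxy
  apply hmax _ hg hsub
  refine ⟨1, ?_⟩
  simpa [add_comm] using h.rfl' (x + y)

theorem Good.total (h : Good b R) (hmax : ∀ S, Good b S → R ⊆ S → S ⊆ R) {x y : M}
    (hx : ∃ l : ℕ, (x, l • b) ∈ R) (hy : ∃ l : ℕ, (y, l • b) ∈ R) :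
    (x, y) ∈ R ∨ (y, x) ∈ R := by
  by_contra hc
  push Not at hc
  obtain ⟨m, n, h1⟩ := h.exists_bad hmax hc.1
  obtain ⟨m', n', h2⟩ := h.exists_bad hmax hc.2
  obtain ⟨l, hl⟩ := hx
  obtain ⟨l', hl'⟩ := hy
  rcases Nat.eq_zero_or_pos m with rfl | hm
  · exact h.nb n (by simpa using h1)
  have h3 := h.add (h.smul h1 m') (h.smul h2 m)
  set u : M := (m' * n + m * n') • b + (m * m') • (x + y) with hu
  have h4 : (u + (m' + m) • b, u + 0) ∈ R := by
    convert h3 using 2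
    · rw [hu]; module
    · rw [hu]; module
  have h5 : (u, (m' * n + m * n' + m * m' * (l + l')) • b) ∈ R := by
    have := h.add (h.rfl' ((m' * n + m * n') • b)) (h.smul (h.add hl hl') (m * m'))
    convert this using 2
    module
  set N := m' * n + m * n' + m * m' * (l + l')
  have h6 := iter h.trans' h.rfl' h.add_right' h4 (N + 1)
  rw [nsmul_zero, add_zero] at h6
  have h7 : (((N + 1) * (m' + m)) • b, u + (N + 1) • (m' + m) • b) ∈ R := by
    rw [mul_nsmul', add_comm u]; exact h.le_add _ _
  have h8 := h.le_of (h.trans' _ _ _ h7 (h.trans' _ _ _ h6 h5))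
  nlinarith

theorem exists_max (h : Good b R) :
    ∃ S, R ⊆ S ∧ Good b S ∧ ∀ T, Good b T → S ⊆ T → T ⊆ S := by
  obtain ⟨S, hRS, hS⟩ := zorn_subset_nonempty {S | Good b S} (by
    intro c hc hch hne
    refine ⟨⋃₀ c, ?_, fun s hs => Set.subset_sUnion_of_mem hs⟩
    obtain ⟨s0, hs0⟩ := hne
    refine ⟨fun x => ⟨s0, hs0, (hc hs0).rfl' x⟩, ?_, ?_, fun x => ⟨s0, hs0, (hc hs0).zero' x⟩, ?_⟩
    · rintro x y z ⟨s, hs, h1⟩ ⟨t, ht, h2⟩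
      rcases hch.total hs ht with hst | hst
      · exact ⟨t, ht, (hc ht).trans' _ _ _ (hst h1) h2⟩
      · exact ⟨s, hs, (hc hs).trans' _ _ _ h1 (hst h2)⟩
    · rintro x y z ⟨s, hs, h1⟩
      exact ⟨s, hs, (hc hs).add_right' _ _ _ h1⟩
    · rintro n ⟨s, hs, h1⟩
      exact (hc hs).nb n h1) R h
  exact ⟨S, hRS, hS.prop, fun T hT hST => hS.le_of_ge hT hST⟩

/-- the state -/
noncomputable def st (b : M) (R : Set (M × M)) (x : M) : ℝ≥0∞ :=
  ⨅ (p : ℕ) (q : ℕ) (_ : 0 < q ∧ (q • x, p • b) ∈ R), (p : ℝ≥0∞) / q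

theorem st_le {x : M} {p q : ℕ} (hq : 0 < q) (h : (q • x, p • b) ∈ R) :
    st b R x ≤ (p : ℝ≥0∞) / q :=
  iInf_le_of_le p (iInf_le_of_le q (iInf_le_of_le ⟨hq, h⟩ le_rfl))

theorem le_st {x : M} {r : ℝ≥0∞}
    (h : ∀ p q : ℕ, 0 < q → (q • x, p • b) ∈ R → r ≤ (p : ℝ≥0∞) / q) : r ≤ st b R x :=
  le_iInf fun p => le_iInf fun q => le_iInf fun hh => h p q hh.1 hh.2

theorem one_le_st (h : Good b R) {x : M} (hx : (b, x) ∈ R) : 1 ≤ st b R x := by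
  refine le_st fun p q hq hpq => ?_
  have := h.le_of (h.trans' _ _ _ (h.smul hx q) hpq)
  rw [ENNReal.le_div_iff_mul_le (by simp; omega) (by simp), one_mul]
  exact_mod_cast this

theorem st_sub (h : Good b R) (x y : M) : st b R (x + y) ≤ st b R x + st b R y := by
  have key : ∀ p q : ℕ, 0 < q → (q • x, p • b) ∈ R → ∀ p' q' : ℕ, 0 < q' →
      (q' • y, p' • b) ∈ R → st b R (x + y) ≤ (p : ℝ≥0∞) / q + (p' : ℝ≥0∞) / q' := by
    intro p q hq h1 p' q' hq' h2
    have h3 := h.add (h.smul h1 q') (h.smul h2 q)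
    have h4 : ((q * q') • (x + y), (q' * p + q * p') • b) ∈ R := by
      convert h3 using 2 <;> module
    refine (st_le (Nat.mul_pos hq hq') h4).trans (le_of_eq ?_)
    have e1 : (p : ℝ≥0∞) / q = (q' * p : ℝ≥0∞) / (q * q') := by
      rw [mul_comm (q : ℝ≥0∞) q', ENNReal.mul_div_mul_left _ _ (by simp; omega) (by simp)]
    have e2 : (p' : ℝ≥0∞) / q' = (q * p' : ℝ≥0∞) / (q * q') := by
      rw [ENNReal.mul_div_mul_left _ _ (by simp; omega) (by simp)]
    rw [e1, e2, ENNReal.div_add_div_same]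
    push_cast; rfl
  conv_rhs => unfold st
  simp only [ENNReal.iInf_add, ENNReal.add_iInf]
  refine le_iInf fun p => le_iInf fun q => le_iInf fun hh => le_iInf fun p' =>
    le_iInf fun q' => le_iInf fun hh' => ?_
  first
    | exact key _ _ hh.1 hh.2 _ _ hh'.1 hh'.2
    | exact key _ _ hh'.1 hh'.2 _ _ hh.1 hh.2

theorem Good.floor (h : Good b R) (hmax : ∀ S, Good b S → R ⊆ S → S ⊆ R) {x : M}
    (hx : ∃ l : ℕ, (x, l • b) ∈ R) : ∃ i : ℕ, (x, (i + 1) • b) ∈ R ∧ (i • b, x) ∈ R := by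
  classical
  have hf := Nat.find_spec hx
  have hmin := fun m => Nat.find_min hx (m := m)
  set i := Nat.find hx
  refine ⟨i - 1, h.trans' _ _ _ hf (h.mono _ (by omega)), ?_⟩
  rcases Nat.eq_zero_or_pos i with h0 | h0
  · rw [h0]; simpa using h.zero' x
  · have := hmin (i - 1) (by omega)
    exact (h.total hmax hx ⟨i - 1, h.rfl' _⟩).resolve_left this

theorem st_super (h : Good b R) (hmax : ∀ S, Good b S → R ⊆ S → S ⊆ R) (x y : M) :
    st b R x + st b R y ≤ st b R (x + y) := by
  refine le_st fun p q hq hpq => ?_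
  have hz : ∀ z : M, (z, x + y) ∈ R → ∀ d : ℕ, ∃ l : ℕ, (d • z, l • b) ∈ R := by
    intro z hz d
    have h1 : (z, q • (x + y)) ∈ R := by
      refine h.trans' _ _ _ hz ?_
      have := h.mono (x + y) (p := 1) (q := q) hq
      rwa [one_nsmul] at this
    refine ⟨d * p, ?_⟩
    rw [mul_nsmul']
    exact h.smul (h.trans' _ _ _ h1 hpq) d
  have key : ∀ d : ℕ, 0 < d → st b R x + st b R y ≤ (p : ℝ≥0∞) / q + 2 / d := by
    intro d hd
    obtain ⟨i, hi, hi'⟩ := h.floor hmax (hz x (h.le_add x y) d)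
    obtain ⟨j, hj, hj'⟩ := h.floor hmax (hz y (by rw [add_comm]; exact h.le_add y x) d)
    have h1 := h.smul (h.add hi' hj') q
    have h2 := h.smul hpq d
    have h3 : (q * (i + j)) ≤ d * p := by
      apply h.le_of
      refine h.trans' _ _ _ ?_ (by rw [mul_nsmul']; exact h2)
      convert h1 using 2 <;> module
    refine (add_le_add (st_le hd hi) (st_le hd hj)).trans ?_
    have h4 : ((i + j : ℕ) : ℝ≥0∞) / d ≤ p / q := by
      rw [ENNReal.div_le_iff (by simp; omega) (by simp), mul_comm, ← mul_div_assoc,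
        ENNReal.le_div_iff_mul_le (by simp; omega) (by simp), mul_comm]
      exact_mod_cast h3
    calc ((i + 1 : ℕ) : ℝ≥0∞) / d + ((j + 1 : ℕ) : ℝ≥0∞) / d
        = ((i + j : ℕ) : ℝ≥0∞) / d + 2 / d := by
          rw [ENNReal.div_add_div_same, ENNReal.div_add_div_same]
          congr 1
          exact_mod_cast (by omega : i + 1 + (j + 1) = i + j + 2)
      _ ≤ _ := add_le_add h4 le_rfl
  have ht : Filter.Tendsto (fun d : ℕ => (p : ℝ≥0∞) / q + 2 / (d : ℝ≥0∞)) Filter.atTop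
      (nhds ((p : ℝ≥0∞) / q + 0)) := by
    apply Filter.Tendsto.const_add
    have := ENNReal.Tendsto.const_mul (a := 2) ENNReal.tendsto_inv_nat_nhds_zero (Or.inr (by simp))
    simpa [div_eq_mul_inv] using this
  rw [add_zero] at ht
  exact ge_of_tendsto ht (Filter.eventually_atTop.2 ⟨1, fun d hd => key d hd⟩)

theorem main (a b : M) (k : ℕ) (hk : ∃ c, a + c = k • b)
    (hno : ∀ n : ℕ, ¬ ∃ c, (n + 1) • a + c = n • b) :
    ∃ ν : M → ℝ≥0∞, ν 0 = 0 ∧ (∀ x y, ν (x + y) = ν x + ν y) ∧ ν b = 1 ∧ 1 ≤ ν a := by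
  have hg : Good b {p : M × M | ∃ m : ℕ, ∃ c, p.1 + m • a + c = p.2 + m • b} := by
    refine ⟨fun x => ⟨0, 0, by simp⟩, ?_, ?_, fun x => ⟨0, x, by simp⟩, ?_⟩
    · rintro x y z ⟨m, c, h1⟩ ⟨l, d, h2⟩
      refine ⟨m + l, c + d, ?_⟩
      simp only at h1 h2 ⊢
      calc x + (m + l) • a + (c + d) = (x + m • a + c) + (l • a + d) := by module
        _ = (y + l • a + d) + m • b := by rw [h1]; module
        _ = _ := by rw [h2]; module
    · rintro x y e ⟨m, c, h1⟩
      refine ⟨m, c, ?_⟩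
      simp only at h1 ⊢
      calc x + e + m • a + c = (x + m • a + c) + e := by module
        _ = _ := by rw [h1]; module
    · rintro n ⟨m, c, h1⟩
      simp only at h1
      obtain ⟨e, he⟩ := hk
      have h2 := iter (M := M) (R := {p : M × M | ∃ c, p.1 + c = p.2}) (c := b + m • a)
        (d := m • b) (u := n • b) (by
          rintro x y z ⟨c, h⟩ ⟨d, h'⟩
          exact ⟨c + d, by simp only at h h' ⊢; rw [← h', ← h, add_assoc]⟩)
        (fun x => ⟨0, by simp⟩) (by
          rintro x y z ⟨c, h⟩
          exact ⟨c, by simp only at h ⊢; rw [← h]; abel⟩)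
        ⟨c, by simp only; rw [← h1]; module⟩ (k * n + 1)
      obtain ⟨f, hf⟩ := h2
      simp only at hf
      refine hno (k * n + k * (k * n + 1) * m) ⟨(k * n) • b + (k * n + 1) • e + k • f, ?_⟩
      calc _ = (k * (k * n + 1) * m) • a + (k * n) • b + (k * n + 1) • (a + e) + k • f := by
            module
        _ = k • (n • b + (k * n + 1) • (b + m • a) + f) := by rw [he]; module
        _ = _ := by rw [hf]; module
  obtain ⟨S, hRS, hS, hmax⟩ := exists_max hg
  refine ⟨st b S, ?_, fun x y => le_antisymm (st_sub hS x y) (st_super hS hmax x y), ?_, ?_⟩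
  · have := st_le (b := b) (R := S) (x := 0) (p := 0) (q := 1) one_pos (by simpa using hS.rfl' 0)
    simpa using this
  · refine le_antisymm ?_ (one_le_st hS (hS.rfl' b))
    have := st_le (b := b) (R := S) (x := b) (p := 1) (q := 1) one_pos (hS.rfl' _)
    simpa using this
  · exact one_le_st hS (hRS ⟨1, 0, by simp [add_comm]⟩)

end AUState

/-- `T(α)` is almost unperforated iff for all `a, b ∈ T(α)`: if `a ≤ kb`
for some `k ∈ ℕ` and `ν(a) < 1` for every state `ν ∈ M_∞(α)` with `ν(b) = 1`, then
`a ≤ b`. -/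
theorem stmt10 {Γ : Type*} [Group Γ] [Countable Γ]
    {X : Type*} [TopologicalSpace X] [CompactSpace X] [T2Space X]
    [TotallyDisconnectedSpace X]
    (α : Γ →* (X ≃ₜ X)) :
    IsAlmostUnperforated α ↔
      ∀ a b : TypeSemigroup α, (∃ k : ℕ, tle α a (k • b)) →
        (∀ ν : TypeSemigroup α → ℝ≥0∞, IsState α ν → ν b = 1 → ν a < 1) →
        tle α a b := by
  constructor
  · rintro hau a b ⟨k, hk⟩ hst
    by_contra hab
    obtain ⟨ν, h0, hadd, hb, ha⟩ := AUState.main a b k hk (fun n hn => hab (hau a b n hn))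
    exact absurd (hst ν ⟨h0, hadd⟩ hb) (not_lt.2 ha)
  · rintro H a b n ⟨c, hc⟩
    refine H a b ⟨n, n • a + c, ?_⟩ ?_
    · rw [← hc, succ_nsmul, ← add_assoc, add_comm a]
    · rintro ν ⟨h0, hadd⟩ hb
      have hs : ∀ (m : ℕ) (x : TypeSemigroup α), ν (m • x) = m * ν x := by
        intro m x
        induction m with
        | zero => simp [h0]
        | succ m ih => rw [succ_nsmul, hadd, ih]; push_cast; ring
      have h1 : ((n + 1 : ℕ) : ℝ≥0∞) * ν a ≤ n := by
        have := congrArg ν hc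
        rw [hadd, hs, hs, hb, mul_one] at this
        rw [← this]; exact le_self_add
      by_contra hcon
      rw [not_lt] at hcon
      have h2 : ((n + 1 : ℕ) : ℝ≥0∞) ≤ n := by
        calc ((n + 1 : ℕ) : ℝ≥0∞) = ((n + 1 : ℕ) : ℝ≥0∞) * 1 := (mul_one _).symm
          _ ≤ _ := by gcongr
          _ ≤ _ := h1
      have h3 : n + 1 ≤ n := by exact_mod_cast h2
      omega
end

section
/- Let α be a minimal action of a countable group Γ by homeomorphisms on a nonempty compact Hausdorff 0-dimensional space X. Then M(α) is nonempty if and only if T(α) is stably finite, i.e., for all a, b ∈ T(α), a + b = b implies a = 0. -/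
open MeasureTheory Set
open scoped ENNReal

section Aux

variable {Γ : Type*} [Group Γ] {X : Type*} [TopologicalSpace X]

lemma aux_inv_apply (α : Γ →* X ≃ₜ X) (γ : Γ) (x : X) : α γ⁻¹ (α γ x) = x := by
  have h : α γ⁻¹ * α γ = 1 := by rw [← map_mul, inv_mul_cancel, map_one]
  exact congrArg (fun g : X ≃ₜ X => g x) h

lemma aux_apply_inv (α : Γ →* X ≃ₜ X) (γ : Γ) (x : X) : α γ (α γ⁻¹ x) = x := by
  have h : α γ * α γ⁻¹ = 1 := by rw [← map_mul, mul_inv_cancel, map_one]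
  exact congrArg (fun g : X ≃ₜ X => g x) h

lemma aux_mul_apply (α : Γ →* X ≃ₜ X) (γ δ : Γ) (x : X) : α (γ * δ) x = α γ (α δ x) := by
  rw [map_mul]; rfl

lemma aux_actC_eq_zero (α : Γ →* X ≃ₜ X) (γ : Γ) (f : C(X, ℕ)) : actC α γ f = 0 ↔ f = 0 := by
  constructor
  · intro h
    ext x
    have := congrArg (fun g : C(X, ℕ) => g (α γ x)) h
    simpa [actC, aux_inv_apply] using this
  · rintro rfl; rfl

lemma aux_add_eq_zero (f g : C(X, ℕ)) : f + g = 0 ↔ f = 0 ∧ g = 0 := by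
  constructor
  · intro h
    have h' : ∀ x, f x + g x = 0 := fun x => congrArg (fun k : C(X, ℕ) => k x) h
    constructor <;> ext x <;> have := h' x <;> simp <;> omega
  · rintro ⟨rfl, rfl⟩; simp

lemma aux_sum_eq_zero {n : ℕ} (h : Fin n → C(X, ℕ)) : ∑ i, h i = 0 ↔ ∀ i, h i = 0 := by
  induction n with
  | zero => simp
  | succ n ih => rw [Fin.sum_univ_succ, aux_add_eq_zero, ih, Fin.forall_fin_succ]

/-- The congruence identifying all nonzero functions. -/
def auxZeroCon (X : Type*) [TopologicalSpace X] : AddCon C(X, ℕ) where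
  r f g := f = 0 ↔ g = 0
  iseqv := ⟨fun _ => Iff.rfl, fun h => h.symm, fun h k => h.trans k⟩
  add' := by
    intro a b c d h k
    show a + c = 0 ↔ b + d = 0
    rw [aux_add_eq_zero, aux_add_eq_zero, h, k]

lemma aux_typeCon_zero (α : Γ →* X ≃ₜ X) (f : C(X, ℕ)) (h : cls α f = 0) : f = 0 := by
  have h1 : typeCon α f 0 := (AddCon.eq _).1 h
  have h2 : typeCon α ≤ auxZeroCon X := by
    refine AddCon.addConGen_le.2 ?_
    rintro f g ⟨n, h, γ, rfl, rfl⟩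
    show _ = 0 ↔ _ = 0
    simp only [aux_sum_eq_zero, aux_actC_eq_zero]
  exact (h2 h1).2 rfl

lemma aux_cls_act (α : Γ →* X ≃ₜ X) (γ : Γ) (f : C(X, ℕ)) : cls α (actC α γ f) = cls α f := by
  refine ((AddCon.eq _).2 ?_).symm
  exact AddCon.le_addConGen _ _ ⟨1, fun _ => f, fun _ => γ, by simp, by simp⟩

lemma aux_cls_add (α : Γ →* X ≃ₜ X) (f g : C(X, ℕ)) : cls α (f + g) = cls α f + cls α g := rfl

lemma aux_cls_nsmul (α : Γ →* X ≃ₜ X) (n : ℕ) (f : C(X, ℕ)) : cls α (n • f) = n • cls α f := rfl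

theorem aux_forward [Countable Γ] [CompactSpace X] (α : Γ →* (X ≃ₜ X)) (hmin : IsMinimalAction α)
    (hne : (invRadon α).Nonempty) (a b : TypeSemigroup α) (hab : a + b = b) : a = 0 := by
  letI : MeasurableSpace X := borel X
  haveI : BorelSpace X := ⟨rfl⟩
  obtain ⟨μ, hμ⟩ := hne
  obtain ⟨hp, -, hinv⟩ : IsProbabilityMeasure μ ∧ μ.Regular ∧
    ∀ γ : Γ, Measure.map ⇑(α γ) μ = μ := hμ
  have hint : ∀ f : C(X, ℕ), Integrable (fun x => (f x : ℝ)) μ := fun f =>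
    Continuous.integrable_of_hasCompactSupport (by fun_prop) (HasCompactSupport.of_compactSpace _)
  let I : C(X, ℕ) →+ ℝ :=
    { toFun := fun f => ∫ x, (f x : ℝ) ∂μ
      map_zero' := by simp
      map_add' := fun f g => by
        rw [← integral_add (hint f) (hint g)]; simp }
  have hI : ∀ γ f, I (actC α γ f) = I f := by
    intro γ f
    show ∫ x, ((f (α γ⁻¹ x) : ℕ) : ℝ) ∂μ = ∫ x, (f x : ℝ) ∂μ
    conv_rhs => rw [← hinv γ⁻¹]
    rw [integral_map (α γ⁻¹).continuous.aemeasurable]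
    exact Continuous.aestronglyMeasurable (by fun_prop)
  have hle : typeCon α ≤ AddCon.ker I := by
    refine AddCon.addConGen_le.2 ?_
    rintro f g ⟨n, h, γ, rfl, rfl⟩
    show I _ = I _
    simp only [map_sum, hI]
  induction a using AddCon.induction_on with | _ f => ?_
  induction b using AddCon.induction_on with | _ g => ?_
  have h1 : typeCon α (f + g) g := (AddCon.eq _).1 hab
  have h2 : I (f + g) = I g := hle h1
  have h3 : I f = 0 := by rw [map_add] at h2; linarith
  suffices f = 0 by subst this; rfl
  have h4 : (fun x => (f x : ℝ)) =ᵐ[μ] 0 :=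
    (integral_eq_zero_iff_of_nonneg (fun x => Nat.cast_nonneg _) (hint f)).1 h3
  have h5 : μ {x | f x ≠ 0} = 0 := by
    have := ae_iff.1 h4
    simpa using this
  by_contra hf
  set U : Set X := {x | f x ≠ 0} with hU
  have hUo : IsOpen U := (isOpen_discrete {n : ℕ | n ≠ 0}).preimage f.continuous
  have hUne : U.Nonempty := by
    by_contra hh
    apply hf
    ext x
    by_contra hx
    exact hh ⟨x, hx⟩
  have hcl : IsClosed (⋃ γ : Γ, (α γ) ⁻¹' U)ᶜ :=
    (isOpen_iUnion fun γ => hUo.preimage (α γ).continuous).isClosed_compl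
  rcases hmin _ hcl (by
    rintro γ _ ⟨x, hx, rfl⟩ hy
    apply hx
    obtain ⟨δ, hδ⟩ := mem_iUnion.1 hy
    refine mem_iUnion.2 ⟨δ * γ, ?_⟩
    simpa [aux_mul_apply] using hδ) with h | h
  · have : μ (⋃ γ : Γ, (α γ) ⁻¹' U) = 0 := by
      refine measure_iUnion_null fun γ => ?_
      rw [← Measure.map_apply (α γ).continuous.measurable hUo.measurableSet, hinv, h5]
    rw [compl_empty_iff.1 h] at this
    simp at this
  · obtain ⟨x, hx⟩ := hUne
    have : x ∈ (⋃ γ : Γ, (α γ) ⁻¹' U)ᶜ := h ▸ mem_univ x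
    apply this
    refine mem_iUnion.2 ⟨1, ?_⟩
    rw [map_one]; exact hx

/-- Approximability of a real function by differences of equivalent integer functions. -/
def auxQ (α : Γ →* X ≃ₜ X) (v : C(X, ℝ)) : Prop :=
  ∀ ε : ℝ, 0 < ε → ∃ (N : ℕ) (F G : C(X, ℕ)), 0 < N ∧ cls α F = cls α G ∧
    ∀ x, |N * v x - ((F x : ℝ) - G x)| ≤ N * ε

lemma auxQ_add (α : Γ →* X ≃ₜ X) {v w : C(X, ℝ)} (hv : auxQ α v) (hw : auxQ α w) :
    auxQ α (v + w) := by
  intro ε hε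
  obtain ⟨N, F, G, hN, hFG, h⟩ := hv (ε / 2) (by linarith)
  obtain ⟨M, F', G', hM, hFG', h'⟩ := hw (ε / 2) (by linarith)
  refine ⟨N * M, M • F + N • F', M • G + N • G', Nat.mul_pos hN hM, ?_, fun x => ?_⟩
  · rw [aux_cls_add, aux_cls_add, aux_cls_nsmul, aux_cls_nsmul, aux_cls_nsmul, aux_cls_nsmul,
      hFG, hFG']
  · have hN' : (0 : ℝ) < N := by exact_mod_cast hN
    have hM' : (0 : ℝ) < M := by exact_mod_cast hM
    have e1 := abs_le.1 (h x)
    have e2 := abs_le.1 (h' x)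
    have a1 := mul_le_mul_of_nonneg_left e1.1 hM'.le
    have a2 := mul_le_mul_of_nonneg_left e1.2 hM'.le
    have a3 := mul_le_mul_of_nonneg_left e2.1 hN'.le
    have a4 := mul_le_mul_of_nonneg_left e2.2 hN'.le
    simp only [ContinuousMap.add_apply, ContinuousMap.coe_nsmul, Pi.smul_apply, smul_eq_mul,
      ContinuousMap.coe_add, Pi.add_apply]
    push_cast
    rw [abs_le]
    constructor <;> nlinarith

lemma aux_approx [CompactSpace X] [T2Space X] [TotallyDisconnectedSpace X] (φ : C(X, ℝ))
    (hφ : ∀ x, 0 ≤ φ x) : ∃ ψ : C(X, ℕ), ∀ x, |φ x - ψ x| ≤ 2 := by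
  have hS : {p : ℝ × ℝ | dist p.1 p.2 < 1} ∈ nhdsSet (diagonal ℝ) := by
    refine IsOpen.mem_nhdsSet (isOpen_lt (by fun_prop) (by fun_prop)) |>.2 ?_
    rintro ⟨a, b⟩ (rfl : a = b)
    simp
  obtain ⟨n, g, h, hg, hgh⟩ := ContinuousMap.exists_finite_approximation_of_mem_nhds_diagonal φ hS
  refine ⟨⟨fun x => ⌊h (g x)⌋₊, (continuous_of_discreteTopology
    (f := fun i : Fin n => ⌊h i⌋₊)).comp hg⟩, fun x => ?_⟩
  have h1 : |φ x - h (g x)| < 1 := hgh x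
  have h0 := hφ x
  rw [abs_lt] at h1
  show |φ x - (⌊h (g x)⌋₊ : ℝ)| ≤ 2
  rw [abs_le]
  have h2 := Nat.lt_floor_add_one (h (g x))
  rcases le_total 0 (h (g x)) with h3 | h3
  · have h4 := Nat.floor_le h3
    constructor <;> linarith
  · rw [Nat.floor_of_nonpos h3]
    push_cast
    constructor <;> linarith

lemma auxQ_gen [CompactSpace X] [T2Space X] [TotallyDisconnectedSpace X]
    (α : Γ →* X ≃ₜ X) (γ : Γ) (φ : C(X, ℝ)) :
    auxQ α (φ.comp (α γ : C(X, X)) - φ) := by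
  intro ε hε
  obtain ⟨N, hN⟩ := exists_nat_gt (4 / ε)
  have hN' : (0 : ℝ) < N := lt_trans (by positivity) hN
  have hb : ∀ x, 0 ≤ φ x + ‖φ‖ := fun x => by
    have := φ.norm_coe_le_norm x
    rw [Real.norm_eq_abs, abs_le] at this
    linarith
  obtain ⟨ψ, hψ⟩ := aux_approx (X := X) ⟨fun x => N * (φ x + ‖φ‖), by fun_prop⟩
    (fun x => mul_nonneg hN'.le (hb x))
  refine ⟨N, actC α γ⁻¹ ψ, ψ, by exact_mod_cast hN', aux_cls_act _ _ _, fun x => ?_⟩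
  have e1 := abs_le.1 (hψ x)
  have e2 := abs_le.1 (hψ (α γ x))
  have e3 : 4 < N * ε := by rwa [div_lt_iff₀ hε] at hN
  have e4 : actC α γ⁻¹ ψ x = ψ (α γ x) := by simp [actC]
  have e5 : (φ.comp (α γ : C(X, X)) - φ) x = φ (α γ x) - φ x := rfl
  rw [e4, e5, abs_le]
  simp only [ContinuousMap.coe_mk] at e1 e2
  constructor <;> nlinarith

/-- The span of the coboundaries. -/
def auxV (α : Γ →* X ≃ₜ X) : Submodule ℝ C(X, ℝ) :=
  Submodule.span ℝ {v | ∃ (γ : Γ) (φ : C(X, ℝ)), v = φ.comp (α γ : C(X, X)) - φ}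

lemma auxV_Q [CompactSpace X] [T2Space X] [TotallyDisconnectedSpace X]
    (α : Γ →* X ≃ₜ X) (v : C(X, ℝ)) (hv : v ∈ auxV α) : auxQ α v := by
  suffices ∀ c : ℝ, auxQ α (c • v) by simpa using this 1
  induction hv using Submodule.span_induction with
  | mem v hv =>
    obtain ⟨γ, φ, rfl⟩ := hv
    intro c
    have h := auxQ_gen α γ (c • φ)
    have e : c • (φ.comp (α γ : C(X, X)) - φ) = (c • φ).comp (α γ : C(X, X)) - c • φ := by
      ext x; simp [mul_sub]
    rw [e]; exact h
  | zero =>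
    intro c ε hε
    exact ⟨1, 0, 0, one_pos, rfl, fun x => by simp [hε.le]⟩
  | add v w _ _ hv hw => intro c; rw [smul_add]; exact auxQ_add α (hv c) (hw c)
  | smul a v _ hv => intro c; rw [smul_smul]; exact hv _

lemma auxV_not_neg [CompactSpace X] [T2Space X] [TotallyDisconnectedSpace X] [Nonempty X]
    (α : Γ →* X ≃ₜ X) (hst : ∀ a b : TypeSemigroup α, a + b = b → a = 0)
    (v : C(X, ℝ)) (hv : v ∈ auxV α) (hneg : ∀ x, v x < 0) : False := by
  obtain ⟨x₀, -, hx₀⟩ := isCompact_univ.exists_isMaxOn univ_nonempty v.continuous.continuousOn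
  have hx : ∀ x, v x ≤ v x₀ := fun x => hx₀ (mem_univ x)
  have h0 := hneg x₀
  obtain ⟨N, F, G, hN, hFG, h⟩ := auxV_Q α v hv (-v x₀ / 2) (by linarith)
  have hN' : (0 : ℝ) < N := by exact_mod_cast hN
  have hlt : ∀ x, F x < G x := by
    intro x
    have h1 := abs_le.1 (h x)
    have h2 := mul_le_mul_of_nonneg_left (hx x) hN'.le
    have h3 : (F x : ℝ) < G x := by nlinarith
    exact_mod_cast h3
  let w : C(X, ℕ) := ⟨fun x => G x - F x, by
    exact (continuous_of_discreteTopology (f := fun p : ℕ × ℕ => p.1 - p.2)).comp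
      (G.continuous.prodMk F.continuous)⟩
  have hw : w + F = G := by
    ext x
    show G x - F x + F x = G x
    have := hlt x
    omega
  have h1 : cls α w + cls α F = cls α F := by
    rw [← aux_cls_add, hw, hFG]
  have h2 := aux_typeCon_zero α w (hst _ _ h1)
  have h3 : G x₀ - F x₀ = 0 := congrArg (fun k : C(X, ℕ) => k x₀) h2
  have := hlt x₀
  omega

theorem aux_functional [CompactSpace X] [T2Space X] [TotallyDisconnectedSpace X] [Nonempty X]
    (α : Γ →* X ≃ₜ X) (hst : ∀ a b : TypeSemigroup α, a + b = b → a = 0) :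
    ∃ L : C(X, ℝ) →ₗ[ℝ] ℝ, (∀ f : C(X, ℝ), (∀ x, 0 ≤ f x) → 0 ≤ L f) ∧ L 1 = 1 ∧
      ∀ (γ : Γ) (f : C(X, ℝ)), L (f.comp (α γ : C(X, X))) = L f := by
  let s : Set C(X, ℝ) := {f | ∀ x, f x < 0}
  have hsc : Convex ℝ s := by
    intro f hf g hg a b ha hb hab x
    have h1 := hf x
    have h2 := hg x
    show a * f x + b * g x < 0
    rcases ha.eq_or_lt with rfl | ha
    · have : b = 1 := by linarith
      subst this; linarith
    · nlinarith
  have hso : IsOpen s := by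
    have : s = {f : C(X, ℝ) | MapsTo f univ (Iio 0)} := by
      ext f; simp [s, MapsTo]
    rw [this]
    exact ContinuousMap.isOpen_setOf_mapsTo isCompact_univ isOpen_Iio
  obtain ⟨f, u, hu1, hu2⟩ := geometric_hahn_banach_open hsc hso (auxV α).convex
    (Set.disjoint_left.2 fun v hv hv' => auxV_not_neg α hst v hv' hv)
  have hu : u ≤ 0 := by simpa using hu2 0 (auxV α).zero_mem
  have hV : ∀ v ∈ auxV α, f v = 0 := by
    intro v hv
    by_contra hne
    have h1 := hu2 (((u - 1) / f v) • v) ((auxV α).smul_mem _ hv)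
    rw [map_smul, smul_eq_mul, div_mul_cancel₀ _ hne] at h1
    linarith
  have hpos : ∀ g : C(X, ℝ), (∀ x, 0 < g x) → 0 < f g := by
    intro g hg
    have := hu1 (-g) (fun x => by simpa using hg x)
    rw [map_neg] at this
    linarith
  have h1 : 0 < f 1 := hpos 1 (fun x => by simp)
  have hnn : ∀ g : C(X, ℝ), (∀ x, 0 ≤ g x) → 0 ≤ f g := by
    intro g hg
    refine le_of_forall_pos_le_add fun ε hε => ?_
    have h2 := hpos (g + (ε / f 1) • 1) (fun x => by
      have := hg x
      have h3 : 0 < ε / f 1 := div_pos hε h1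
      simp; linarith)
    rw [map_add, map_smul, smul_eq_mul, div_mul_cancel₀ _ h1.ne'] at h2
    exact h2.le
  refine ⟨(f 1)⁻¹ • f.toLinearMap, fun g hg => ?_, ?_, fun γ g => ?_⟩
  · exact mul_nonneg (inv_nonneg.2 h1.le) (hnn g hg)
  · exact inv_mul_cancel₀ h1.ne'
  · have := hV _ (Submodule.subset_span ⟨γ, g, rfl⟩)
    rw [map_sub, sub_eq_zero] at this
    show (f 1)⁻¹ * f _ = (f 1)⁻¹ * f _
    rw [this]

theorem aux_backward [CompactSpace X] [T2Space X] [TotallyDisconnectedSpace X] [Nonempty X]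
    (α : Γ →* X ≃ₜ X) (hst : ∀ a b : TypeSemigroup α, a + b = b → a = 0) :
    (invRadon α).Nonempty := by
  letI : MeasurableSpace X := borel X
  haveI : BorelSpace X := ⟨rfl⟩
  obtain ⟨L, hL, hL1, hLinv⟩ := aux_functional α hst
  let Λ₀ : CompactlySupportedContinuousMap X ℝ →ₗ[ℝ] ℝ :=
    { toFun := fun f => L f.toContinuousMap
      map_add' := fun f g => L.map_add f.toContinuousMap g.toContinuousMap
      map_smul' := fun c f => L.map_smul c f.toContinuousMap }
  let Λ : CompactlySupportedContinuousMap X ℝ →ₚ[ℝ] ℝ :=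
    PositiveLinearMap.mk₀ Λ₀ (fun f hf => hL _ (fun x => hf x))
  have key : ∀ f : C(X, ℝ), ∫ x, f x ∂(RealRMK.rieszMeasure Λ) = L f := fun f =>
    RealRMK.integral_rieszMeasure Λ ⟨f, HasCompactSupport.of_compactSpace _⟩
  refine ⟨RealRMK.rieszMeasure Λ, ?_, inferInstance, fun γ => ?_⟩
  · have h1 := key 1
    rw [hL1] at h1
    simp only [ContinuousMap.one_apply, integral_const, smul_eq_mul, mul_one] at h1
    constructor
    rw [measureReal_def] at h1
    rwa [← ENNReal.toReal_eq_one_iff]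
  · haveI : (Measure.map (α γ) (RealRMK.rieszMeasure Λ)).Regular :=
      Measure.Regular.map (α γ)
    refine Measure.ext_of_integral_eq_on_compactlySupported fun f => ?_
    have h0 : Continuous (fun x => f x) := f.continuous
    rw [integral_map (f := fun x => f x) (α γ).continuous.aemeasurable h0.aestronglyMeasurable]
    have h1 := key (f.toContinuousMap.comp (α γ : C(X, X)))
    rw [hLinv, ← key] at h1
    exact h1

end Aux

/-- Let `α` be a minimal action of a countable group `Γ` by
homeomorphisms on a nonempty compact Hausdorff `0`-dimensional space `X`. Then `M(α)` is
nonempty iff `T(α)` is stably finite (`a + b = b` implies `a = 0`). -/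
theorem stmt12 {Γ : Type*} [Group Γ] [Countable Γ]
    {X : Type*} [TopologicalSpace X] [CompactSpace X] [T2Space X]
    [TotallyDisconnectedSpace X] [Nonempty X]
    (α : Γ →* (X ≃ₜ X)) (hmin : IsMinimalAction α) :
    (invRadon α).Nonempty ↔ ∀ a b : TypeSemigroup α, a + b = b → a = 0 := by
  exact ⟨fun h a b hab => aux_forward α hmin h a b hab, aux_backward α⟩
end

section
/- Let Γ be a countable group and α a minimal action of Γ by homeomorphisms on the Cantor space X = {0,1}^ℕ. Then there exist a nonempty compact metrizable 0-dimensional perfect space Y, a free minimal action β of Γ by homeomorphisms on Y such that T(β) is unperforated and the algebraic preorder ≤ on T(β) is a partial order (antisymmetric), and a continuous surjection π : Y → X satisfying π(β(γ)(y)) = α(γ)(π(y)) for all γ ∈ Γ and y ∈ Y. In particular, β has dynamical comparison. -/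
open MeasureTheory Set
open scoped ENNReal

namespace Stmt14
open Filter

/-- Closure lemma. -/
theorem exists_closed_countable {T I : Type*} [Countable I] (op : I → T → T → T)
    (S0 : Set T) (h0 : S0.Countable) :
    ∃ S : Set T, S.Countable ∧ S0 ⊆ S ∧ ∀ i, ∀ x ∈ S, ∀ y ∈ S, op i x y ∈ S := by
  let step : Set T → Set T := fun A => A ∪ ⋃ i, Set.image2 (op i) A A
  let it : ℕ → Set T := fun n => step^[n] S0
  have hsucc : ∀ n, it (n+1) = step (it n) := fun n => Function.iterate_succ_apply' step n S0
  have hmono : Monotone it := monotone_nat_of_le_succ fun n => by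
    rw [hsucc]; exact subset_union_left
  refine ⟨⋃ n, it n, ?_, ?_, ?_⟩
  · refine countable_iUnion fun n => ?_
    induction n with
    | zero => exact h0
    | succ n ih =>
      rw [hsucc]
      exact ih.union (countable_iUnion fun i => ih.image2 ih _)
  · exact subset_iUnion it 0
  · intro i x hx y hy
    obtain ⟨n, hn⟩ := mem_iUnion.1 hx
    obtain ⟨m, hm⟩ := mem_iUnion.1 hy
    refine mem_iUnion.2 ⟨max n m + 1, ?_⟩
    rw [hsucc]
    exact Or.inr (mem_iUnion.2 ⟨i, _, hmono (le_max_left n m) hn, _, hmono (le_max_right n m) hm, rfl⟩)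

attribute [local instance] Ultrafilter.semigroup

theorem exists_min_idem (Γ : Type*) [Group Γ] :
    ∃ u : Ultrafilter Γ, u * u = u ∧ ∀ q : Ultrafilter Γ, ∃ p : Ultrafilter Γ, p * (q * u) = u := by
  let S : Set (Set (Ultrafilter Γ)) :=
    { N | IsClosed N ∧ N.Nonempty ∧ ∀ m, ∀ m' ∈ N, m * m' ∈ N }
  have hz : ∃ N', Minimal (· ∈ S) N' := by
    refine zorn_superset _ fun c hcs hc => ?_
    refine
      ⟨⋂₀ c, ⟨isClosed_sInter fun t ht => (hcs ht).1, ?_, fun m m' hm' => ?_⟩, fun s hs =>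
        Set.sInter_subset_of_mem hs⟩
    · obtain rfl | hcnemp := c.eq_empty_or_nonempty
      · rw [Set.sInter_empty]
        apply Set.univ_nonempty
      rw [Set.sInter_eq_iInter]
      refine @IsCompact.nonempty_iInter_of_directed_nonempty_isCompact_isClosed _ _ _ hcnemp.coe_sort
          ((↑) : c → Set (Ultrafilter Γ)) ?_ ?_ ?_ ?_
      · exact DirectedOn.directed_val (IsChain.directedOn hc.symm)
      exacts [fun i => (hcs i.prop).2.1, fun i => (hcs i.prop).1.isCompact, fun i => (hcs i.prop).1]
    · rw [Set.mem_sInter]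
      exact fun t ht => (hcs ht).2.2 m m' (Set.mem_sInter.mp hm' t ht)
  obtain ⟨N, hN⟩ := hz
  obtain ⟨Nc, Nne, Nl⟩ := hN.prop
  obtain ⟨u, huN, huu⟩ := exists_idempotent_in_compact_subsemigroup
    (M := Ultrafilter Γ) Ultrafilter.continuous_mul_left N Nne Nc.isCompact
    (fun m _ m' hm' => Nl m m' hm')
  refine ⟨u, huu, fun q => ?_⟩
  have : (Set.range (· * (q * u)) : Set (Ultrafilter Γ)) = N := by
    apply hN.eq_of_subset
    · refine ⟨?_, ⟨_, q, rfl⟩, ?_⟩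
      · exact (isCompact_range (Ultrafilter.continuous_mul_left (q * u))).isClosed
      · rintro m _ ⟨m', rfl⟩
        exact ⟨m * m', mul_assoc _ _ _⟩
    · rintro _ ⟨m', rfl⟩
      exact Nl _ _ (Nl _ _ huN)
  rw [← this] at huN
  exact huN

/-- the properties of the ultrafilter in elementary form -/
structure UMin {Γ : Type*} [Group Γ] (u : Ultrafilter Γ) : Prop where
  idem : ∀ p : Γ → Prop, (∀ᶠ x in u, p x) ↔ ∀ᶠ x in u, ∀ᶠ y in u, p (x * y)
  min : ∀ q : Ultrafilter Γ, ∃ r : Ultrafilter Γ, ∀ p : Γ → Prop,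
    (∀ᶠ x in u, p x) ↔ ∀ᶠ a in r, ∀ᶠ b in q, ∀ᶠ c in u, p (a * (b * c))

theorem exists_umin (Γ : Type*) [Group Γ] : ∃ u : Ultrafilter Γ, UMin u := by
  obtain ⟨u, h1, h2⟩ := exists_min_idem Γ
  refine ⟨u, fun p => ?_, fun q => ?_⟩
  · conv_lhs => rw [← h1]
    exact Ultrafilter.eventually_mul u u p
  · obtain ⟨r, hr⟩ := h2 q
    refine ⟨r, fun p => ?_⟩
    conv_lhs => rw [← hr]
    exact Iff.rfl

/-- invariance + boundedness -/
structure Good {Γ : Type*} [Group Γ] (u : Ultrafilter Γ) (F : Γ → ℕ) : Prop where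
  bdd : ∃ N, ∀ x, F x ≤ N
  inv : ∀ x, ∀ᶠ y in u, F (x * y) = F x

section
variable {Γ : Type*} [Group Γ] {u : Ultrafilter Γ}

theorem Good.op₂ {F G : Γ → ℕ} (hF : Good u F) (hG : Good u G) (φ : ℕ → ℕ → ℕ) :
    Good u (fun x => φ (F x) (G x)) := by
  obtain ⟨N, hN⟩ := hF.bdd
  obtain ⟨M, hM⟩ := hG.bdd
  refine ⟨⟨∑ i ∈ Finset.range (N+1), ∑ j ∈ Finset.range (M+1), φ i j, fun x => ?_⟩, fun x => ?_⟩
  · refine le_trans ?_ (Finset.single_le_sum (f := fun i => ∑ j ∈ Finset.range (M+1), φ i j)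
      (fun _ _ => Nat.zero_le _) (Finset.mem_range.2 (Nat.lt_succ_of_le (hN x))))
    exact Finset.single_le_sum (f := fun j => φ (F x) j)
      (fun _ _ => Nat.zero_le _) (Finset.mem_range.2 (Nat.lt_succ_of_le (hM x)))
  · filter_upwards [hF.inv x, hG.inv x] with y h1 h2
    rw [h1, h2]

theorem Good.trans {F : Γ → ℕ} (hF : Good u F) (g : Γ) : Good u (fun x => F (g * x)) := by
  obtain ⟨N, hN⟩ := hF.bdd
  refine ⟨⟨N, fun x => hN _⟩, fun x => ?_⟩
  filter_upwards [hF.inv (g * x)] with y h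
  rw [← h, mul_assoc]

theorem Good.const (n : ℕ) : Good u (fun _ => n) := ⟨⟨n, fun _ => le_rfl⟩, fun _ => by simp⟩

theorem exists_ulim (h : Γ → ℕ) (hb : ∃ N, ∀ x, h x ≤ N) (x : Γ) :
    ∃ n, ∀ᶠ y in u, h (x * y) = n := by
  obtain ⟨N, hN⟩ := hb
  have : ∀ᶠ y in u, ∃ i ∈ (Finset.range (N+1) : Set ℕ), h (x * y) = i :=
    Eventually.of_forall fun y => ⟨_, by simpa using Nat.lt_succ_of_le (hN _), rfl⟩
  rw [Ultrafilter.eventually_exists_mem_iff (Finset.finite_toSet _)] at this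
  obtain ⟨n, _, hn⟩ := this
  exact ⟨n, hn⟩

/-- averaging -/
theorem exists_avg (hu : UMin u) (h : Γ → ℕ) (hb : ∃ N, ∀ x, h x ≤ N) :
    ∃ k : Γ → ℕ, Good u k ∧ ∀ x, ∀ᶠ y in u, h (x * y) = k x := by
  choose k hk using exists_ulim (u := u) h hb
  refine ⟨k, ⟨?_, ?_⟩, hk⟩
  · obtain ⟨N, hN⟩ := hb
    refine ⟨N, fun x => ?_⟩
    obtain ⟨y, hy⟩ := (hk x).exists
    rw [← hy]; exact hN _
  · intro x
    have := (hu.idem _).1 (hk x)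
    filter_upwards [this] with y hy
    obtain ⟨z, hz1, hz2⟩ := (hy.and (hk (x * y))).exists
    rw [← hz2, ← hz1, mul_assoc]

theorem Good.synd (hu : UMin u) {F : Γ → ℕ} (hF : Good u F) {a : Γ} (ha : F a ≠ 0) :
    ∃ T : Finset Γ, ∀ x, ∃ t ∈ T, F (t * x) ≠ 0 := by
  by_contra! hcon
  obtain ⟨q, hq⟩ := Ultrafilter.exists_ultrafilter_of_finite_inter_nonempty
    (Set.range fun t : Γ => {x | F (t * x) = 0}) (by
      classical
      intro T hT
      obtain ⟨T', rfl⟩ : ∃ T' : Finset Γ, T = T'.image fun t : Γ => {x | F (t * x) = 0} := by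
        have := Finset.subset_set_image_iff (s := univ) (t := T)
          (f := fun t : Γ => {x | F (t * x) = 0})
        rw [image_univ] at this
        obtain ⟨T', _, h⟩ := this.1 hT
        exact ⟨T', h.symm⟩
      obtain ⟨x, hx⟩ := hcon T'
      refine ⟨x, ?_⟩
      simpa using hx)
  obtain ⟨r, hr⟩ := hu.min q
  have h1 := (hr (fun y => F (a * y) ≠ 0)).1 (by
    filter_upwards [hF.inv a] with y hy
    rwa [hy])
  obtain ⟨b, hb⟩ := h1.exists
  have h2 : ∀ᶠ c in (q : Filter Γ), F (a * b * c) = 0 := hq ⟨a * b, rfl⟩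
  obtain ⟨c, hc1, hc2⟩ := (hb.and h2).exists
  obtain ⟨d, hd1, hd2⟩ := (hc1.and (hF.inv (a * b * c))).exists
  apply hd1
  rw [← hc2, ← hd2]
  congr 1
  group

/-- For `g ≠ 1` a large set moved off itself. -/
theorem exists_free_set (g : Γ) (hg : g ≠ 1) :
    ∃ E : Set Γ, (∀ x ∈ E, g * x ∉ E) ∧ ∀ x, x ∈ E ∨ g * x ∈ E ∨ g⁻¹ * x ∈ E := by
  have hz : ∃ E : Set Γ, Maximal (· ∈ {E : Set Γ | ∀ x ∈ E, g * x ∉ E}) E := by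
    refine zorn_subset _ fun c hcs hc => ⟨⋃₀ c, ?_, fun s hs => subset_sUnion_of_mem hs⟩
    rintro x ⟨s, hs, hxs⟩ ⟨t, ht, hxt⟩
    rcases hc.total hs ht with h | h
    · exact hcs ht x (h hxs) hxt
    · exact hcs hs x hxs (h hxt)
  obtain ⟨E, hE⟩ := hz
  refine ⟨E, hE.prop, fun x => ?_⟩
  by_contra! hx
  obtain ⟨h1, h2, h3⟩ := hx
  refine h1 (hE.le_of_ge (y := insert x E) ?_ (subset_insert _ _) (mem_insert _ _))
  rintro y (rfl | hy) (h | h)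
  · exact hg (by simpa using h)
  · exact h2 h
  · apply h3; rw [← h]; simpa using hy
  · exact hE.prop y hy h

theorem exists_free_fun (hu : UMin u) (g : Γ) (hg : g ≠ 1) :
    ∃ F : Γ → ℕ, Good u F ∧ (∀ x, F x = 0 ∨ F (g * x) = 0) ∧
      ∀ x, F x ≠ 0 ∨ F (g * x) ≠ 0 ∨ F (g⁻¹ * x) ≠ 0 := by
  classical
  obtain ⟨E, h1, h2⟩ := exists_free_set g hg
  obtain ⟨k, hk, hk2⟩ := exists_avg hu (fun x => if x ∈ E then 1 else 0)
    ⟨1, fun x => by split_ifs <;> simp⟩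
  refine ⟨k, hk, fun x => ?_, fun x => ?_⟩
  · obtain ⟨y, hy1, hy2⟩ := ((hk2 x).and (hk2 (g * x))).exists
    rw [← hy1, ← hy2]
    by_cases h : x * y ∈ E
    · right; rw [mul_assoc]; simp [h1 _ h]
    · left; simp [h]
  · obtain ⟨y, hy1, hy2, hy3⟩ := ((hk2 x).and ((hk2 (g * x)).and (hk2 (g⁻¹ * x)))).exists
    rw [← hy1, ← hy2, ← hy3]
    simpa [mul_assoc] using h2 (x * y)

end
end Stmt14

namespace Stmt14
open Filter
open scoped Pointwise Classical

section
variable {Γ : Type*} [Group Γ]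

/-- Hall-type domination of functions on the group. -/
def Dom (F G : Γ → ℕ) : Prop :=
  ∃ S : Finset Γ, ∀ A : Finset Γ, ∑ a ∈ A, F a ≤ ∑ b ∈ S * A, G b

theorem Dom.trans {F G H : Γ → ℕ} (h1 : Dom F G) (h2 : Dom G H) : Dom F H := by
  obtain ⟨S, hS⟩ := h1
  obtain ⟨T, hT⟩ := h2
  refine ⟨T * S, fun A => (hS A).trans ?_⟩
  rw [mul_assoc]
  exact hT _

theorem Dom.of_le {F G : Γ → ℕ} (h : ∀ x, F x ≤ G x) : Dom F G :=
  ⟨1, fun A => by rw [one_mul]; exact Finset.sum_le_sum fun x _ => h x⟩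

theorem Dom.add {F G F' G' : Γ → ℕ} (h1 : Dom F G) (h2 : Dom F' G') : Dom (F + F') (G + G') := by
  obtain ⟨S, hS⟩ := h1
  obtain ⟨T, hT⟩ := h2
  refine ⟨S ∪ T, fun A => ?_⟩
  simp only [Pi.add_apply, Finset.sum_add_distrib]
  refine add_le_add ((hS A).trans ?_) ((hT A).trans ?_)
  · exact Finset.sum_le_sum_of_subset (Finset.mul_subset_mul_right Finset.subset_union_left)
  · exact Finset.sum_le_sum_of_subset (Finset.mul_subset_mul_right Finset.subset_union_right)

theorem Dom.shift (F : Γ → ℕ) (g : Γ) : Dom F (fun x => F (g⁻¹ * x)) := by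
  refine ⟨{g}, fun A => le_of_eq ?_⟩
  rw [Finset.singleton_mul, ← Finset.image_smul, Finset.sum_image (by intro x _ y _ h; simpa using h)]
  simp

theorem Dom.shift' (F : Γ → ℕ) (g : Γ) : Dom (fun x => F (g⁻¹ * x)) F := by
  have := Dom.shift (fun x => F (g⁻¹ * x)) g⁻¹
  simpa using this

theorem Dom.of_nsmul {F G : Γ → ℕ} {n : ℕ} (hn : 1 ≤ n)
    (h : Dom (fun x => n * F x) (fun x => n * G x)) : Dom F G := by
  obtain ⟨S, hS⟩ := h
  refine ⟨S, fun A => ?_⟩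
  have := hS A
  rw [← Finset.mul_sum, ← Finset.mul_sum] at this
  exact Nat.le_of_mul_le_mul_left this hn

theorem Dom.hall {F G : Γ → ℕ} (h : Dom F G) :
    ∃ (S : Finset Γ) (φ : (Σ x, Fin (F x)) → (Σ x, Fin (G x))), Function.Injective φ ∧
      ∀ z, (φ z).1 * z.1⁻¹ ∈ S := by
  obtain ⟨S, hS⟩ := h
  let t : (Σ x, Fin (F x)) → Finset (Σ x, Fin (G x)) :=
    fun z => (S * {z.1}).sigma fun _ => Finset.univ
  have key := (Finset.all_card_le_biUnion_card_iff_exists_injective t).1 (by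
    intro s
    let A := s.image Sigma.fst
    calc s.card ≤ (A.sigma fun _ => Finset.univ : Finset (Σ x, Fin (F x))).card := by
          refine Finset.card_le_card fun z hz => ?_
          simp only [Finset.mem_sigma, Finset.mem_univ, and_true]
          exact Finset.mem_image_of_mem _ hz
      _ = ∑ a ∈ A, F a := by simp
      _ ≤ ∑ b ∈ S * A, G b := hS A
      _ = ((S * A).sigma fun _ => Finset.univ : Finset (Σ x, Fin (G x))).card := by simp
      _ ≤ _ := by
          refine Finset.card_le_card fun z hz => ?_
          simp only [Finset.mem_sigma, Finset.mem_univ, and_true] at hz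
          obtain ⟨a, ha, b, hb, hab⟩ := Finset.mem_mul.1 hz
          obtain ⟨w, hw, rfl⟩ := Finset.mem_image.1 hb
          refine Finset.mem_biUnion.2 ⟨w, hw, ?_⟩
          simp only [t, Finset.mem_sigma, Finset.mem_univ, and_true]
          rw [← hab]
          exact Finset.mul_mem_mul ha (Finset.mem_singleton_self _))
  obtain ⟨φ, hφ, hφt⟩ := key
  refine ⟨S, φ, hφ, fun z => ?_⟩
  have := hφt z
  simp only [t, Finset.mem_sigma, Finset.mem_univ, and_true] at this
  obtain ⟨a, ha, b, hb, hab⟩ := Finset.mem_mul.1 this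
  rw [Finset.mem_singleton] at hb
  rw [← hab, hb]
  simpa using ha

theorem wit_of_map {F G : Γ → ℕ} (S : Finset Γ) (φ : (Σ x, Fin (F x)) → (Σ x, Fin (G x)))
    (hφ : Function.Injective φ) (hS : ∀ z, (φ z).1 * z.1⁻¹ ∈ S) :
    ∃ h : Γ → Γ → ℕ, (∀ x, F x = ∑ s ∈ S, h s x) ∧ (∀ x, ∑ s ∈ S, h s (s⁻¹ * x) ≤ G x) ∧
      (Function.Surjective φ → ∀ x, ∑ s ∈ S, h s (s⁻¹ * x) = G x) := by
  let P : Γ → (x : Γ) → Finset (Fin (F x)) := fun s x =>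
    Finset.univ.filter fun i => (φ ⟨x, i⟩).1 = s * x
  let Q : Γ → Finset (Σ x, Fin (G x)) := fun x => ({x} : Finset Γ).sigma fun _ => Finset.univ
  have hQ : ∀ x, (Q x).card = G x := fun x => by simp [Q]
  let D : Γ → Finset (Σ s : Γ, Σ x, Fin (F x)) := fun x =>
    S.sigma fun s => (P s (s⁻¹ * x)).map ⟨Sigma.mk (s⁻¹ * x), sigma_mk_injective⟩
  have hD : ∀ x, (D x).card = ∑ s ∈ S, (P s (s⁻¹ * x)).card := fun x => by
    simp [D, Finset.card_sigma]
  have hmem : ∀ x (z : Σ s : Γ, Σ x, Fin (F x)), z ∈ D x ↔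
      z.1 ∈ S ∧ z.2.1 = z.1⁻¹ * x ∧ (φ z.2).1 = x := by
    rintro x ⟨s, y, i⟩
    simp only [D, P, Finset.mem_sigma, Finset.mem_map, Finset.mem_filter, Finset.mem_univ,
      true_and, Function.Embedding.coeFn_mk]
    constructor
    · rintro ⟨h1, j, hj, he⟩
      have hy : s⁻¹ * x = y := congrArg Sigma.fst he
      subst hy
      obtain rfl : j = i := by simpa using he
      exact ⟨h1, rfl, by simpa using hj⟩
    · rintro ⟨h1, rfl, h3⟩
      exact ⟨h1, i, by simpa using h3, rfl⟩
  have hmaps : ∀ x, ∀ z ∈ D x, φ z.2 ∈ Q x := fun x z hz => by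
    simp [Q, ((hmem x z).1 hz).2.2]
  have hinj : ∀ x, Set.InjOn (fun z : Σ s : Γ, Σ x, Fin (F x) => φ z.2) (D x) := by
    rintro x ⟨s, y⟩ hz ⟨s', y'⟩ hz' he
    have h1 := ((hmem x _).1 hz).2.1
    have h2 := ((hmem x _).1 hz').2.1
    obtain rfl : y = y' := hφ he
    obtain rfl : s = s' := by simpa using h1.symm.trans h2
    rfl
  refine ⟨fun s x => (P s x).card, fun x => ?_, fun x => ?_, fun hsurj x => ?_⟩
  · have := Finset.card_eq_sum_card_fiberwise (s := (Finset.univ : Finset (Fin (F x)))) (t := S)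
      (f := fun i => (φ ⟨x, i⟩).1 * x⁻¹) (fun i _ => hS ⟨x, i⟩)
    rw [Finset.card_univ, Fintype.card_fin] at this
    rw [this]
    refine Finset.sum_congr rfl fun s _ => ?_
    congr 1
    ext i
    simp [P, mul_inv_eq_iff_eq_mul]
  · rw [← hD, ← hQ]
    exact Finset.card_le_card_of_injOn (fun z => φ z.2) (hmaps x) (hinj x)
  · rw [← hD, ← hQ]
    refine le_antisymm (Finset.card_le_card_of_injOn (fun z => φ z.2) (hmaps x) (hinj x)) ?_
    refine Finset.card_le_card_of_surjOn (fun z => φ z.2) ?_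
    intro w hw
    obtain ⟨y, rfl⟩ := hsurj w
    have hx : (φ y).1 = x := by simpa [Q] using hw
    refine ⟨⟨(φ y).1 * y.1⁻¹, y⟩, (hmem x _).2 ⟨hS y, ?_, hx⟩, rfl⟩
    simp [hx]

theorem Dom.wit {F G : Γ → ℕ} (hD : Dom F G) :
    ∃ (S : Finset Γ) (h : Γ → Γ → ℕ), (∀ x, F x = ∑ s ∈ S, h s x) ∧
      (∀ x, ∑ s ∈ S, h s (s⁻¹ * x) ≤ G x) ∧
      (Dom G F → ∀ x, ∑ s ∈ S, h s (s⁻¹ * x) = G x) := by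
  obtain ⟨S, φ, hφ, hS⟩ := hD.hall
  by_cases hD' : Dom G F
  · obtain ⟨T, ψ, hψ, hT⟩ := hD'.hall
    obtain ⟨θ, hθ, hθS⟩ := Function.Embedding.schroeder_bernstein_of_rel hφ hψ
      (fun a b => b.1 * a.1⁻¹ ∈ S ∪ T⁻¹) (fun a => Finset.mem_union_left _ (hS a))
      (fun b => Finset.mem_union_right _ (by simpa using hT b))
    obtain ⟨h, h1, h2, h3⟩ := wit_of_map _ θ hθ.1 hθS
    exact ⟨_, h, h1, h2, fun _ => h3 hθ.2⟩
  · obtain ⟨h, h1, h2, h3⟩ := wit_of_map _ φ hφ hS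
    exact ⟨_, h, h1, h2, fun h' => (hD' h').elim⟩

theorem Dom.goodwit {u : Ultrafilter Γ} (hu : UMin u) {F G : Γ → ℕ} (hF : Good u F)
    (hG : Good u G) (hD : Dom F G) :
    ∃ (S : Finset Γ) (h : Γ → Γ → ℕ), (∀ s, Good u (h s)) ∧ (∀ x, F x = ∑ s ∈ S, h s x) ∧
      (∀ x, ∑ s ∈ S, h s (s⁻¹ * x) ≤ G x) ∧
      (Dom G F → ∀ x, ∑ s ∈ S, h s (s⁻¹ * x) = G x) := by
  obtain ⟨S, h, h1, h2, h3⟩ := hD.wit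
  obtain ⟨N, hN⟩ := hF.bdd
  have : ∀ s, ∃ k : Γ → ℕ, Good u k ∧ (s ∈ S → ∀ x, ∀ᶠ y in u, h s (x * y) = k x) := by
    intro s
    by_cases hs : s ∈ S
    · obtain ⟨k, hk, hk'⟩ := exists_avg hu (h s) ⟨N, fun x => le_trans (by
        rw [h1 x]; exact Finset.single_le_sum (f := fun s => h s x) (fun _ _ => Nat.zero_le _) hs)
          (hN x)⟩
      exact ⟨k, hk, fun _ => hk'⟩
    · exact ⟨fun _ => 0, Good.const 0, fun h => (hs h).elim⟩
  choose k hk hk' using this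
  have e1 : ∀ (x : Γ), ∀ᶠ y in u, ∀ s ∈ S, h s (x * y) = k s x := fun x =>
    (Finset.eventually_all S).2 fun s hs => hk' s hs x
  have e2 : ∀ (x : Γ), ∀ᶠ y in u, ∀ s ∈ S, h s (s⁻¹ * (x * y)) = k s (s⁻¹ * x) := fun x =>
    (Finset.eventually_all S).2 fun s hs => by
      filter_upwards [hk' s hs (s⁻¹ * x)] with y hy
      rw [← hy, mul_assoc]
  refine ⟨S, k, hk, fun x => ?_, fun x => ?_, fun hD' x => ?_⟩
  · obtain ⟨y, hy1, hy2⟩ := ((e1 x).and (hF.inv x)).exists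
    rw [← hy2, h1]
    exact Finset.sum_congr rfl hy1
  · obtain ⟨y, hy1, hy2⟩ := ((e2 x).and (hG.inv x)).exists
    rw [← hy2, ← Finset.sum_congr rfl hy1]
    exact h2 _
  · obtain ⟨y, hy1, hy2⟩ := ((e2 x).and (hG.inv x)).exists
    rw [← hy2, ← Finset.sum_congr rfl hy1]
    exact h3 hD' _

end
end Stmt14

namespace Stmt14
open Filter
open scoped Pointwise Classical

/-- A countable family of functions on the group, closed under the needed operations. -/
structure Fam {Γ : Type*} [Group Γ] (α : Γ →* (Cantor ≃ₜ Cantor)) {ι : Type} (e : ι → Γ → ℕ)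
    (x₁ : Cantor) : Prop where
  inj : Function.Injective e
  bdd : ∀ i, ∃ N, ∀ x, e i x ≤ N
  add : ∀ i j, ∃ k, ∀ x, e k x = e i x + e j x
  mul : ∀ i j, ∃ k, ∀ x, e k x = e i x * e j x
  ind : ∀ i n, ∃ k, ∀ x, e k x = if e i x = n then 1 else 0
  const : ∀ n, ∃ k, ∀ x, e k x = n
  trans : ∀ (g : Γ) i, ∃ k, ∀ x, e k x = e i (g * x)
  synd : ∀ i a, e i a ≠ 0 → ∃ T : Finset Γ, ∀ x, ∃ t ∈ T, e i (t * x) ≠ 0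
  free : ∀ g : Γ, g ≠ 1 → ∃ i, (∀ x, e i x = 0 ∨ e i (g * x) = 0) ∧
      ∀ x, e i x ≠ 0 ∨ e i (g * x) ≠ 0 ∨ e i (g⁻¹ * x) ≠ 0
  wit : ∀ i j, Dom (e i) (e j) → ∃ (S : Finset Γ) (h : Γ → ι), (∀ x, e i x = ∑ s ∈ S, e (h s) x) ∧
      (∀ x, ∑ s ∈ S, e (h s) (s⁻¹ * x) ≤ e j x) ∧
      (Dom (e j) (e i) → ∀ x, ∑ s ∈ S, e (h s) (s⁻¹ * x) = e j x)
  fac : ∀ n : ℕ, ∃ i, ∀ x, e i x = if α x x₁ n = true then 1 else 0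

theorem exists_point {Γ : Type*} [Group Γ] (α : Γ →* (Cantor ≃ₜ Cantor)) {u : Ultrafilter Γ}
    (hu : UMin u) : ∃ x₁ : Cantor, ∀ (n : ℕ) (g : Γ), ∀ᶠ y in u, α (g * y) x₁ n = α g x₁ n := by
  let x₀ : Cantor := fun _ => true
  have hmul : ∀ (g h : Γ) (x : Cantor), α (g * h) x = α g (α h x) := fun g h x => by
    rw [map_mul]; rfl
  obtain ⟨x₁, -, hx₁⟩ := (isCompact_univ (X := Cantor)).ultrafilter_le_nhds
    (u.map fun g => α g x₀) (by simp)
  have ht : Tendsto (fun g => α g x₀) u (nhds x₁) := hx₁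
  have hc : ∀ (g : Γ) (n : ℕ), Continuous fun x : Cantor => α g x n := fun g n =>
    (continuous_apply n).comp (α g).continuous
  have hev : ∀ (f : Γ → Cantor), Tendsto f u (nhds x₁) → ∀ (g : Γ) (n : ℕ),
      ∀ᶠ y in u, α g (f y) n = α g x₁ n := fun f hf g n => by
    have := ((hc g n).tendsto x₁).comp hf
    rw [nhds_discrete] at this
    exact tendsto_pure.1 this
  have ht1 : Tendsto (fun g => α g x₁) u (nhds x₁) := by
    rw [tendsto_pi_nhds]
    intro n
    rw [nhds_discrete]
    refine tendsto_pure.2 ?_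
    have h1 := hev _ ht 1 n
    have h2 := (hu.idem _).1 h1
    filter_upwards [h2] with g hg
    obtain ⟨y, hy1, hy2⟩ := (hg.and (hev _ ht g n)).exists
    rw [map_one] at hy1
    change α (g * y) x₀ n = x₁ n at hy1
    rw [← hy1, ← hy2, hmul]
  refine ⟨x₁, fun n g => ?_⟩
  filter_upwards [hev _ ht1 g n] with y hy
  rw [hmul, hy]

theorem exists_fam {Γ : Type*} [Group Γ] [Countable Γ] (α : Γ →* (Cantor ≃ₜ Cantor)) :
    ∃ (ι : Type) (_ : Countable ι) (e : ι → Γ → ℕ) (x₁ : Cantor), Fam α e x₁ := by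
  obtain ⟨u, hu⟩ := exists_umin Γ
  obtain ⟨x₁, hx₁⟩ := exists_point α hu
  let T := {F : Γ → ℕ // Good u F}
  have hw : ∀ F G : T, ∃ (S : Finset Γ) (h : Γ → T), Dom F.1 G.1 → (∀ x, F.1 x = ∑ s ∈ S, (h s).1 x) ∧
      (∀ x, ∑ s ∈ S, (h s).1 (s⁻¹ * x) ≤ G.1 x) ∧
      (Dom G.1 F.1 → ∀ x, ∑ s ∈ S, (h s).1 (s⁻¹ * x) = G.1 x) := by
    intro F G
    by_cases hD : Dom F.1 G.1
    · obtain ⟨S, h, h1, h2⟩ := hD.goodwit hu F.2 G.2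
      exact ⟨S, fun s => ⟨h s, h1 s⟩, fun _ => h2⟩
    · exact ⟨∅, fun _ => F, fun h => (hD h).elim⟩
  choose WS W hW using hw
  have hfree : ∀ g : Γ, ∃ F : T, g ≠ 1 → (∀ x, F.1 x = 0 ∨ F.1 (g * x) = 0) ∧
      ∀ x, F.1 x ≠ 0 ∨ F.1 (g * x) ≠ 0 ∨ F.1 (g⁻¹ * x) ≠ 0 := by
    intro g
    by_cases hg : g = 1
    · exact ⟨⟨_, Good.const 0⟩, fun h => (h hg).elim⟩
    · obtain ⟨F, h1, h2⟩ := exists_free_fun hu g hg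
      exact ⟨⟨F, h1⟩, fun _ => h2⟩
  choose FF hFF using hfree
  let E : ℕ → T := fun n => ⟨fun x => if α x x₁ n = true then 1 else 0,
    ⟨1, fun x => by split_ifs <;> simp⟩, fun g => by
      filter_upwards [hx₁ n g] with y hy
      rw [hy]⟩
  let op : (Bool ⊕ ℕ) ⊕ (ℕ ⊕ (Γ ⊕ Γ)) → T → T → T := fun i F G =>
    match i with
    | .inl (.inl true) => ⟨_, F.2.op₂ G.2 (· + ·)⟩
    | .inl (.inl false) => ⟨_, F.2.op₂ G.2 (· * ·)⟩
    | .inl (.inr n) => ⟨_, F.2.op₂ G.2 (fun a _ => if a = n then 1 else 0)⟩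
    | .inr (.inl n) => ⟨_, Good.const n⟩
    | .inr (.inr (.inl g)) => ⟨_, F.2.trans g⟩
    | .inr (.inr (.inr s)) => W F G s
  obtain ⟨𝓕, hc, h0, hop⟩ := exists_closed_countable op (range FF ∪ range E)
    ((countable_range _).union (countable_range _))
  have := hc.to_subtype
  have : Small.{0} 𝓕 := Countable.toSmall _
  let q : Shrink.{0} 𝓕 ≃ 𝓕 := (equivShrink 𝓕).symm
  have hq : ∀ F ∈ 𝓕, ∃ k, (q k).1 = F := fun F hF => ⟨q.symm ⟨F, hF⟩, by simp⟩
  refine ⟨Shrink.{0} 𝓕, q.injective.countable, fun i => (q i).1.1, x₁, ?_⟩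
  constructor
  · exact Subtype.val_injective.comp (Subtype.val_injective.comp q.injective)
  · exact fun i => (q i).1.2.bdd
  · intro i j
    obtain ⟨k, hk⟩ := hq _ (hop (.inl (.inl true)) _ (q i).2 _ (q j).2)
    exact ⟨k, fun x => by rw [hk]⟩
  · intro i j
    obtain ⟨k, hk⟩ := hq _ (hop (.inl (.inl false)) _ (q i).2 _ (q j).2)
    exact ⟨k, fun x => by rw [hk]⟩
  · intro i n
    obtain ⟨k, hk⟩ := hq _ (hop (.inl (.inr n)) _ (q i).2 _ (q i).2)
    exact ⟨k, fun x => by rw [hk]⟩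
  · intro n
    have hE := h0 (Or.inr (mem_range_self 0))
    obtain ⟨k, hk⟩ := hq _ (hop (.inr (.inl n)) _ hE _ hE)
    exact ⟨k, fun x => by rw [hk]⟩
  · intro g i
    obtain ⟨k, hk⟩ := hq _ (hop (.inr (.inr (.inl g))) _ (q i).2 _ (q i).2)
    exact ⟨k, fun x => by rw [hk]⟩
  · exact fun i a ha => (q i).1.2.synd hu ha
  · intro g hg
    obtain ⟨k, hk⟩ := hq _ (h0 (Or.inl (mem_range_self g)))
    refine ⟨k, ?_⟩
    rw [hk]
    exact hFF g hg
  · intro i j hD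
    have : ∀ s, ∃ k, (q k).1 = W (q i).1 (q j).1 s := fun s =>
      hq _ (hop (.inr (.inr (.inr s))) _ (q i).2 _ (q j).2)
    choose h hh using this
    refine ⟨WS (q i).1 (q j).1, h, ?_⟩
    simp only [hh]
    exact hW _ _ hD
  · intro n
    obtain ⟨k, hk⟩ := hq _ (h0 (Or.inr (mem_range_self n)))
    exact ⟨k, fun x => by rw [hk]⟩

end Stmt14

namespace Stmt14
open Filter
open scoped Pointwise Classical

section
variable {Γ : Type*} [Group Γ] {α : Γ →* (Cantor ≃ₜ Cantor)} {ι : Type} {e : ι → Γ → ℕ}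
  {x₁ : Cantor}

/-- The space. -/
abbrev YS (e : ι → Γ → ℕ) : Type := ↥(closure (range fun (x : Γ) (i : ι) => e i x))

/-- The orbit points. -/
def pt (e : ι → Γ → ℕ) (x : Γ) : YS e := ⟨fun i => e i x, subset_closure (mem_range_self x)⟩

theorem pt_apply (x : Γ) (i : ι) : (pt e x).1 i = e i x := rfl

theorem exists_nhd {y : YS e} {U : Set (YS e)} (hU : IsOpen U) (hy : y ∈ U) :
    ∃ I : Finset ι, ∀ z : YS e, (∀ i ∈ I, z.1 i = y.1 i) → z ∈ U := by
  obtain ⟨V, hV, rfl⟩ := isOpen_induced_iff.1 hU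
  obtain ⟨I, w, h1, h2⟩ := isOpen_pi_iff.1 hV y.1 hy
  refine ⟨I, fun z hz => h2 fun i hi => ?_⟩
  rw [hz i hi]
  exact (h1 i hi).2

theorem dens (y : YS e) (I : Finset ι) : ∃ x, ∀ i ∈ I, y.1 i = e i x := by
  have ho : IsOpen ((I : Set ι).pi fun i => ({y.1 i} : Set ℕ)) :=
    isOpen_set_pi I.finite_toSet fun i _ => isOpen_discrete _
  obtain ⟨z, hz, x, rfl⟩ := mem_closure_iff.1 y.2 _ ho (fun i _ => rfl)
  exact ⟨x, fun i hi => (hz i hi).symm⟩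

theorem dense_pt {U : Set (YS e)} (hU : IsOpen U) (hne : U.Nonempty) : ∃ x, pt e x ∈ U := by
  obtain ⟨y, hy⟩ := hne
  obtain ⟨I, hI⟩ := exists_nhd hU hy
  obtain ⟨x, hx⟩ := dens y I
  exact ⟨x, hI _ fun i hi => (hx i hi).symm⟩

theorem denseRange_pt : DenseRange (pt e) := by
  intro y
  rw [mem_closure_iff]
  intro U hU hy
  obtain ⟨x, hx⟩ := dense_pt hU ⟨y, hy⟩
  exact ⟨_, hx, mem_range_self x⟩

theorem eq_of_pt {Z : Type*} [TopologicalSpace Z] [T2Space Z] {f g : YS e → Z} (hf : Continuous f)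
    (hg : Continuous g) (h : ∀ x, f (pt e x) = g (pt e x)) (y : YS e) : f y = g y :=
  congrFun (denseRange_pt.equalizer hf hg (funext h)) y

theorem all_of_pt {P : YS e → Prop} (hc : IsClopen {y | P y}) (h : ∀ x, P (pt e x)) (y : YS e) :
    P y := by
  by_contra hy
  obtain ⟨x, hx⟩ := dense_pt hc.compl.isOpen ⟨y, hy⟩
  exact hx (h x)

theorem cont_ev (i : ι) : Continuous fun y : YS e => y.1 i :=
  (continuous_apply i).comp continuous_subtype_val

theorem Fam.compact (H : Fam α e x₁) : CompactSpace (YS e) := by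
  choose N hN using H.bdd
  rw [← isCompact_iff_compactSpace]
  refine IsCompact.of_isClosed_subset (isCompact_univ_pi (s := fun i => Set.Iic (N i))
    fun i => (Set.finite_Iic _).isCompact) isClosed_closure ?_
  refine closure_minimal ?_ (isClosed_set_pi fun i _ => isClosed_discrete _)
  rintro _ ⟨x, rfl⟩ i _
  exact hN i x

/-- index shift -/
noncomputable def Fam.τ (H : Fam α e x₁) (g : Γ) (i : ι) : ι := (H.trans g i).choose

theorem Fam.τ_spec (H : Fam α e x₁) (g : Γ) (i : ι) (x : Γ) : e (H.τ g i) x = e i (g * x) :=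
  (H.trans g i).choose_spec x

theorem Fam.τ_mul (H : Fam α e x₁) (g h : Γ) (i : ι) : H.τ (g * h) i = H.τ h (H.τ g i) :=
  H.inj (funext fun x => by simp only [H.τ_spec, mul_assoc])

theorem Fam.τ_one (H : Fam α e x₁) (i : ι) : H.τ 1 i = i :=
  H.inj (funext fun x => by simp only [H.τ_spec, one_mul])

/-- the map of the action -/
noncomputable def Fam.act (H : Fam α e x₁) (g : Γ) (y : YS e) : YS e :=
  ⟨fun i => y.1 (H.τ g i), by
    have hc : Continuous fun (z : ι → ℕ) (i : ι) => z (H.τ g i) :=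
      continuous_pi fun i => continuous_apply _
    refine map_mem_closure hc y.2 ?_
    rintro _ ⟨x, rfl⟩
    exact ⟨g * x, funext fun i => (H.τ_spec g i x).symm⟩⟩

theorem Fam.act_pt (H : Fam α e x₁) (g x : Γ) : H.act g (pt e x) = pt e (g * x) :=
  Subtype.ext (funext fun i => H.τ_spec g i x)

theorem Fam.act_mul (H : Fam α e x₁) (g h : Γ) (y : YS e) :
    H.act (g * h) y = H.act g (H.act h y) :=
  Subtype.ext (funext fun i => congrArg y.1 (H.τ_mul g h i))

theorem Fam.act_one (H : Fam α e x₁) (y : YS e) : H.act 1 y = y :=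
  Subtype.ext (funext fun i => congrArg y.1 (H.τ_one i))

theorem Fam.act_cont (H : Fam α e x₁) (g : Γ) : Continuous (H.act g) :=
  Continuous.subtype_mk (continuous_pi fun i => cont_ev _) _

/-- the action -/
noncomputable def Fam.β (H : Fam α e x₁) : Γ →* (YS e ≃ₜ YS e) where
  toFun g :=
    { toFun := H.act g
      invFun := H.act g⁻¹
      left_inv := fun y => by rw [← H.act_mul, inv_mul_cancel, H.act_one]
      right_inv := fun y => by rw [← H.act_mul, mul_inv_cancel, H.act_one]
      continuous_toFun := H.act_cont g
      continuous_invFun := H.act_cont g⁻¹ }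
  map_one' := Homeomorph.ext fun y => H.act_one y
  map_mul' g h := Homeomorph.ext fun y => H.act_mul g h y

theorem Fam.β_pt (H : Fam α e x₁) (g x : Γ) : H.β g (pt e x) = pt e (g * x) := H.act_pt g x

theorem Fam.β_apply (H : Fam α e x₁) (g : Γ) (y : YS e) (i : ι) :
    (H.β g y).1 i = y.1 (H.τ g i) := rfl

theorem Fam.β_mul (H : Fam α e x₁) (g h : Γ) (y : YS e) : H.β (g * h) y = H.β g (H.β h y) :=
  H.act_mul g h y

theorem Fam.β_inv (H : Fam α e x₁) (g : Γ) (y : YS e) : H.β g⁻¹ (H.β g y) = y := by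
  rw [← H.β_mul, inv_mul_cancel, map_one]; rfl

theorem Fam.β_inv' (H : Fam α e x₁) (g : Γ) (y : YS e) : H.β g (H.β g⁻¹ y) = y := by
  rw [← H.β_mul, mul_inv_cancel, map_one]; rfl

theorem clopen_ev (P : ℕ → Prop) (i : ι) : IsClopen {y : YS e | P (y.1 i)} :=
  (isClopen_discrete {n | P n}).preimage (cont_ev i)

theorem Fam.free_β (H : Fam α e x₁) (g : Γ) (y : YS e) (h : H.β g y = y) : g = 1 := by
  by_contra hg
  obtain ⟨i, h1, h2⟩ := H.free g hg
  have hinv : H.β g⁻¹ y = y := by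
    conv_lhs => rw [← h]
    exact H.β_inv g y
  obtain ⟨x, hx⟩ := dens y {i, H.τ g i, H.τ g⁻¹ i}
  have a0 := hx i (by simp)
  have a1 := hx (H.τ g i) (by simp)
  have a2 := hx (H.τ g⁻¹ i) (by simp)
  rw [H.τ_spec] at a1 a2
  rw [← H.β_apply, h] at a1
  rw [← H.β_apply, hinv] at a2
  have b1 := h1 x
  have b2 := h2 x
  rw [← a0, ← a1] at b1
  rw [← a0, ← a1, ← a2] at b2
  tauto

theorem Fam.minimal_β (H : Fam α e x₁) : IsMinimalAction H.β := by
  intro F hF hinv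
  by_contra! hcon
  obtain ⟨⟨y, hy⟩, hne⟩ := hcon
  obtain ⟨z, hz⟩ := (ne_univ_iff_exists_notMem F).1 hne
  obtain ⟨I, hI⟩ := exists_nhd hF.isOpen_compl hz
  -- a single index
  have key : ∀ I : Finset ι, ∃ k, ∀ w : YS e, w.1 k ≠ 0 ↔ ∀ i ∈ I, w.1 i = z.1 i := by
    intro I
    induction I using Finset.induction_on with
    | empty =>
      obtain ⟨k, hk⟩ := H.const 1
      refine ⟨k, fun w => ?_⟩
      obtain ⟨x, hx⟩ := dens w {k}
      simp [hx k (by simp), hk]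
    | insert i I _ ih =>
      obtain ⟨k, hk⟩ := ih
      obtain ⟨j, hj⟩ := H.ind i (z.1 i)
      obtain ⟨l, hl⟩ := H.mul j k
      refine ⟨l, fun w => ?_⟩
      obtain ⟨x, hx⟩ := dens w {i, j, k, l}
      have e1 : w.1 l = (if w.1 i = z.1 i then 1 else 0) * w.1 k := by
        rw [hx l (by simp), hx i (by simp), hx k (by simp), hl, hj]
      rw [e1, Finset.forall_mem_insert, ← hk]
      simp
  obtain ⟨k, hk⟩ := key I
  have hzk : z.1 k ≠ 0 := (hk z).2 fun _ _ => rfl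
  obtain ⟨a, ha⟩ := dens z {k}
  rw [ha k (by simp)] at hzk
  obtain ⟨T, hT⟩ := H.synd k a hzk
  obtain ⟨x, hx⟩ := dens y (T.image fun t => H.τ t k)
  obtain ⟨t, ht, htx⟩ := hT x
  rw [← H.τ_spec, ← hx _ (Finset.mem_image_of_mem _ ht), ← H.β_apply] at htx
  exact hI _ ((hk _).1 htx) (hinv t (mem_image_of_mem _ hy))

theorem Fam.rep_clopen (H : Fam α e x₁) {A : Set (YS e)} (hA : IsClopen A) :
    ∃ k, ∀ y : YS e, y.1 k = if y ∈ A then 1 else 0 := by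
  have := H.compact
  have h1 : ∃ k, A ⊆ {y : YS e | y.1 k ≠ 0} ∧ {y : YS e | y.1 k ≠ 0} ⊆ A := by
    refine IsCompact.induction_on (p := fun s => ∃ k, s ⊆ {y : YS e | y.1 k ≠ 0} ∧
      {y : YS e | y.1 k ≠ 0} ⊆ A) hA.isClosed.isCompact ?_ ?_ ?_ ?_
    · obtain ⟨k, hk⟩ := H.const 0
      refine ⟨k, empty_subset _, fun y hy => ?_⟩
      obtain ⟨x, hx⟩ := dens y {k}
      exact (hy (by rw [hx k (by simp), hk])).elim
    · rintro s t hst ⟨k, hk1, hk2⟩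
      exact ⟨k, hst.trans hk1, hk2⟩
    · rintro s t ⟨k, hk1, hk2⟩ ⟨l, hl1, hl2⟩
      obtain ⟨m, hm⟩ := H.add k l
      have hm' : ∀ y : YS e, y.1 m = y.1 k + y.1 l := fun y => by
        obtain ⟨x, hx⟩ := dens y {k, l, m}
        rw [hx k (by simp), hx l (by simp), hx m (by simp), hm]
      refine ⟨m, ?_, ?_⟩
      · rintro y (hy | hy)
        · have := hk1 hy
          simp only [mem_ofPred_eq] at this ⊢
          rw [hm']; omega
        · have := hl1 hy
          simp only [mem_ofPred_eq] at this ⊢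
          rw [hm']; omega
      · intro y hy
        simp only [mem_ofPred_eq] at hy
        rw [hm'] at hy
        by_cases h : y.1 k = 0
        · exact hl2 (show y.1 l ≠ 0 by omega)
        · exact hk2 h
    · intro y hy
      obtain ⟨I, hI⟩ := exists_nhd hA.isOpen hy
      have key : ∀ I : Finset ι, ∃ k, ∀ w : YS e, w.1 k ≠ 0 ↔ ∀ i ∈ I, w.1 i = y.1 i := by
        intro I
        induction I using Finset.induction_on with
        | empty =>
          obtain ⟨k, hk⟩ := H.const 1
          refine ⟨k, fun w => ?_⟩
          obtain ⟨x, hx⟩ := dens w {k}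
          simp [hx k (by simp), hk]
        | insert i I _ ih =>
          obtain ⟨k, hk⟩ := ih
          obtain ⟨j, hj⟩ := H.ind i (y.1 i)
          obtain ⟨l, hl⟩ := H.mul j k
          refine ⟨l, fun w => ?_⟩
          obtain ⟨x, hx⟩ := dens w {i, j, k, l}
          have e1 : w.1 l = (if w.1 i = y.1 i then 1 else 0) * w.1 k := by
            rw [hx l (by simp), hx i (by simp), hx k (by simp), hl, hj]
          rw [e1, Finset.forall_mem_insert, ← hk]
          simp
      obtain ⟨k, hk⟩ := key I
      refine ⟨{w : YS e | w.1 k ≠ 0}, mem_nhdsWithin_of_mem_nhds ?_, k, subset_rfl,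
        fun w hw => hI w ((hk w).1 hw)⟩
      exact (clopen_ev (fun n => n ≠ 0) k).isOpen.mem_nhds ((hk y).2 fun _ _ => rfl)
  obtain ⟨k, hk1, hk2⟩ := h1
  obtain ⟨j, hj⟩ := H.ind k 0
  obtain ⟨l, hl⟩ := H.ind j 0
  refine ⟨l, fun y => ?_⟩
  obtain ⟨x, hx⟩ := dens y {k, j, l}
  have e1 : y.1 l = if y.1 k = 0 then 0 else 1 := by
    rw [hx l (by simp), hx k (by simp), hl, hj]
    split_ifs <;> simp_all
  rw [e1]
  by_cases hy : y ∈ A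
  · have : y.1 k ≠ 0 := hk1 hy
    simp [hy, this]
  · have : y.1 k = 0 := by
      by_contra h
      exact hy (hk2 h)
    simp [hy, this]

theorem Fam.rep (H : Fam α e x₁) (f : C(YS e, ℕ)) : ∃ k, ∀ y : YS e, f y = y.1 k := by
  have := H.compact
  have key : ∀ N : ℕ, ∃ k, ∀ y : YS e, y.1 k = min (f y) N := by
    intro N
    induction N with
    | zero =>
      obtain ⟨k, hk⟩ := H.const 0
      refine ⟨k, fun y => ?_⟩
      obtain ⟨x, hx⟩ := dens y {k}
      rw [hx k (by simp), hk]
      simp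
    | succ N ih =>
      obtain ⟨k, hk⟩ := ih
      obtain ⟨j, hj⟩ := H.rep_clopen (A := {y | N < f y})
        ((isClopen_discrete {n | N < n}).preimage f.continuous)
      obtain ⟨l, hl⟩ := H.add k j
      refine ⟨l, fun y => ?_⟩
      obtain ⟨x, hx⟩ := dens y {k, j, l}
      rw [hx l (by simp), hl, ← hx k (by simp), ← hx j (by simp), hk, hj]
      simp only [mem_ofPred_eq]
      split_ifs <;> omega
  obtain ⟨N, hN⟩ := (isCompact_range f.continuous).bddAbove
  obtain ⟨k, hk⟩ := key N
  refine ⟨k, fun y => ?_⟩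
  rw [hk, min_eq_left (hN (mem_range_self y))]

end
end Stmt14

namespace Stmt14
open Filter
open scoped Pointwise Classical

section
variable {Γ : Type*} [Group Γ] {α : Γ →* (Cantor ≃ₜ Cantor)} {ι : Type} {e : ι → Γ → ℕ}
  {x₁ : Cantor}

/-- pull back to the group -/
def pull (f : C(YS e, ℕ)) : Γ → ℕ := fun x => f (pt e x)

theorem Dom.sum {κ : Type*} (s : Finset κ) (F G : κ → Γ → ℕ) (h : ∀ i, Dom (F i) (G i)) :
    Dom (∑ i ∈ s, F i) (∑ i ∈ s, G i) := by
  induction s using Finset.induction_on with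
  | empty => simpa using Dom.of_le fun _ => le_rfl
  | insert i s hi ih =>
    rw [Finset.sum_insert hi, Finset.sum_insert hi]
    exact (h i).add ih

theorem pull_add (f g : C(YS e, ℕ)) : pull (f + g) = pull f + pull g := rfl

theorem pull_sum {κ : Type*} (s : Finset κ) (f : κ → C(YS e, ℕ)) :
    pull (∑ i ∈ s, f i) = ∑ i ∈ s, pull (f i) := by
  funext x
  simp [pull]

theorem Fam.pull_act (H : Fam α e x₁) (g : Γ) (f : C(YS e, ℕ)) :
    pull (actC H.β g f) = fun x => pull f (g⁻¹ * x) := by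
  funext x
  change f (H.β g⁻¹ (pt e x)) = _
  rw [H.β_pt]; rfl

theorem Fam.relDom (H : Fam α e x₁) {f g : C(YS e, ℕ)} (h : TypeRel H.β f g) :
    Dom (pull f) (pull g) ∧ Dom (pull g) (pull f) := by
  obtain ⟨n, k, γ, rfl, rfl⟩ := h
  rw [pull_sum, pull_sum]
  simp only [H.pull_act]
  exact ⟨Dom.sum _ _ _ fun i => Dom.shift _ _, Dom.sum _ _ _ fun i => Dom.shift' _ _⟩

/-- mutual domination as a congruence -/
def domCon (e : ι → Γ → ℕ) : AddCon C(YS e, ℕ) where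
  r f g := Dom (pull f) (pull g) ∧ Dom (pull g) (pull f)
  iseqv := ⟨fun f => ⟨Dom.of_le fun _ => le_rfl, Dom.of_le fun _ => le_rfl⟩, fun h => ⟨h.2, h.1⟩,
    fun h h' => ⟨h.1.trans h'.1, h'.2.trans h.2⟩⟩
  add' h h' := ⟨h.1.add h'.1, h.2.add h'.2⟩

theorem Fam.conDom (H : Fam α e x₁) {f g : C(YS e, ℕ)} (h : typeCon H.β f g) :
    Dom (pull f) (pull g) ∧ Dom (pull g) (pull f) := by
  have : typeCon H.β ≤ domCon e := AddCon.addConGen_le.2 fun f g h => H.relDom h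
  exact this h

theorem Fam.witY (H : Fam α e x₁) {f g : C(YS e, ℕ)} (hD : Dom (pull f) (pull g)) :
    ∃ (S : Finset Γ) (h : Γ → C(YS e, ℕ)), f = ∑ s ∈ S, h s ∧
      (∀ y, (∑ s ∈ S, actC H.β s (h s)) y ≤ g y) ∧
      (Dom (pull g) (pull f) → g = ∑ s ∈ S, actC H.β s (h s)) := by
  obtain ⟨i, hi⟩ := H.rep f
  obtain ⟨j, hj⟩ := H.rep g
  have hi' : pull f = e i := funext fun x => hi _
  have hj' : pull g = e j := funext fun x => hj _
  rw [hi', hj'] at hD ⊢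
  obtain ⟨S, h, h1, h2, h3⟩ := H.wit i j hD
  let k : Γ → C(YS e, ℕ) := fun s => ⟨fun y => y.1 (h s), cont_ev _⟩
  have hk : ∀ x, (∑ s ∈ S, actC H.β s (k s)) (pt e x) = ∑ s ∈ S, e (h s) (s⁻¹ * x) := by
    intro x
    rw [ContinuousMap.sum_apply]
    refine Finset.sum_congr rfl fun s _ => ?_
    change (H.β s⁻¹ (pt e x)).1 (h s) = _
    rw [H.β_pt]; rfl
  refine ⟨S, k, ?_, ?_, fun hD' => ?_⟩
  · ext y
    refine eq_of_pt f.continuous (∑ s ∈ S, k s).continuous (fun x => ?_) y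
    rw [hi, ContinuousMap.sum_apply]
    exact h1 x
  · refine all_of_pt ?_ fun x => ?_
    · exact (isClopen_discrete {p : ℕ × ℕ | p.1 ≤ p.2}).preimage
        ((∑ s ∈ S, actC H.β s (k s)).continuous.prodMk g.continuous)
    · rw [hk, hj]; exact h2 x
  · ext y
    refine eq_of_pt g.continuous (∑ s ∈ S, actC H.β s (k s)).continuous (fun x => ?_) y
    rw [hk, hj]
    exact (h3 hD' x).symm

theorem typeRel_of_finset {X : Type*} [TopologicalSpace X] (β : Γ →* (X ≃ₜ X)) (S : Finset Γ)
    (h : Γ → C(X, ℕ)) : TypeRel β (∑ s ∈ S, h s) (∑ s ∈ S, actC β s (h s)) := by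
  refine ⟨S.card, fun i => h (S.equivFin.symm i), fun i => S.equivFin.symm i, ?_, ?_⟩
  · rw [← Finset.sum_coe_sort]
    exact (Equiv.sum_comp S.equivFin.symm fun s : S => h s).symm
  · rw [← Finset.sum_coe_sort]
    exact (Equiv.sum_comp S.equivFin.symm fun s : S => actC β s (h s)).symm

theorem Fam.cls_eq (H : Fam α e x₁) {f g : C(YS e, ℕ)} (h1 : Dom (pull f) (pull g))
    (h2 : Dom (pull g) (pull f)) : cls H.β f = cls H.β g := by
  obtain ⟨S, h, e1, -, e2⟩ := H.witY h1
  refine (AddCon.eq _).2 ?_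
  rw [e1, e2 h2]
  exact AddConGen.Rel.of _ _ (typeRel_of_finset _ _ _)

theorem Fam.tle_iff (H : Fam α e x₁) {f g : C(YS e, ℕ)} :
    tle H.β (cls H.β f) (cls H.β g) ↔ Dom (pull f) (pull g) := by
  constructor
  · rintro ⟨c, hc⟩
    induction c using AddCon.induction_on with
    | H k =>
      have : typeCon H.β (f + k) g := (AddCon.eq _).1 hc
      refine Dom.trans (Dom.of_le fun x => ?_) (H.conDom this).1
      exact Nat.le_add_right _ _
  · intro hD
    obtain ⟨S, h, e1, e2, -⟩ := H.witY hD
    let g' := ∑ s ∈ S, actC H.β s (h s)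
    let c : C(YS e, ℕ) := ⟨fun y => g y - g' y, by
      exact (continuous_of_discreteTopology (f := fun p : ℕ × ℕ => p.1 - p.2)).comp
        (g.continuous.prodMk g'.continuous)⟩
    have hg : g = g' + c := by
      ext y
      have := e2 y
      change g y = g' y + (g y - g' y)
      change g' y ≤ g y at this
      omega
    refine ⟨cls H.β c, ?_⟩
    have hfg : cls H.β f = cls H.β g' := by
      refine (AddCon.eq _).2 ?_
      rw [e1]
      exact AddConGen.Rel.of _ _ (typeRel_of_finset _ _ _)
    rw [hfg, hg]
    rfl

theorem Fam.unperf (H : Fam α e x₁) : IsUnperforated H.β := by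
  intro a b n hn h
  induction a using AddCon.induction_on with
  | H f =>
  induction b using AddCon.induction_on with
  | H g =>
  have h' : tle H.β (cls H.β (n • f)) (cls H.β (n • g)) := h
  refine H.tle_iff.2 (Dom.of_nsmul hn ?_)
  have := H.tle_iff.1 h'
  convert this using 1
  · funext x; simp [pull]
  · funext x; simp [pull]

theorem Fam.antisymm (H : Fam α e x₁) : TleAntisymm H.β := by
  intro a b h1 h2
  induction a using AddCon.induction_on with
  | H f =>
  induction b using AddCon.induction_on with
  | H g =>
  exact H.cls_eq (H.tle_iff.1 h1) (H.tle_iff.1 h2)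

theorem Fam.subeq (H : Fam α e x₁) {A B : Set (YS e)} {f g : C(YS e, ℕ)}
    (hf : ∀ y, f y = if y ∈ A then 1 else 0) (hg : ∀ y, g y = if y ∈ B then 1 else 0)
    (hD : Dom (pull f) (pull g)) : Subequidecomposable H.β A B := by
  obtain ⟨S, h, e1, e2, -⟩ := H.witY hD
  have e1' : ∀ y, ∑ s ∈ S, h s y = if y ∈ A then 1 else 0 := fun y => by
    rw [← hf, e1, ContinuousMap.sum_apply]
  have e2' : ∀ y, ∑ s ∈ S, h s (H.β s⁻¹ y) ≤ if y ∈ B then 1 else 0 := fun y => by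
    rw [← hg]
    refine le_trans (le_of_eq ?_) (e2 y)
    rw [ContinuousMap.sum_apply]
    rfl
  have two : ∀ (k : Γ → ℕ), ∑ s ∈ S, k s ≤ 1 → ∀ s ∈ S, ∀ t ∈ S, s ≠ t → k s ≠ 0 → k t = 0 := by
    intro k hk s hs t ht hst hks
    have := Finset.sum_le_sum_of_subset (f := k) (s := {s, t}) (t := S)
      (by intro r hr; simp at hr; rcases hr with rfl | rfl <;> assumption)
    rw [Finset.sum_pair hst] at this
    omega
  have le1 : ∀ (p : Prop), (if p then 1 else 0 : ℕ) ≤ 1 := fun p => by split_ifs <;> simp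
  let q := S.equivFin.symm
  have hq : ∀ i j, i ≠ j → (q i : Γ) ≠ q j := fun i j hij h => hij (q.injective (Subtype.ext h))
  refine ⟨S.card, fun i => {y | h (q i) y ≠ 0}, fun i => q i, fun i => ?_, fun i j hij => ?_, ?_,
    fun i j hij => ?_, fun i => ?_⟩
  · exact (isClopen_discrete {n | n ≠ 0}).preimage (h (q i)).continuous
  · refine Set.disjoint_left.2 ?_
    intro y hy hy'
    exact hy' (two (fun s => h s y) ((e1' y).trans_le (le1 _)) _ (q i).2 _ (q j).2 (hq i j hij) hy)
  · ext y
    simp only [mem_iUnion]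
    have := e1' y
    constructor
    · rintro ⟨i, hi⟩
      by_contra hy
      rw [if_neg hy, Finset.sum_eq_zero_iff] at this
      exact hi (this _ (q i).2)
    · intro hy
      rw [if_pos hy] at this
      obtain ⟨s, hs, hs'⟩ := Finset.exists_ne_zero_of_sum_ne_zero (this.trans_ne one_ne_zero)
      refine ⟨q.symm ⟨s, hs⟩, ?_⟩
      simpa using hs'
  · refine Set.disjoint_left.2 ?_
    rintro z ⟨y, hy, rfl⟩ ⟨y', hy', hz⟩
    have k1 : h (q i) (H.β (q i : Γ)⁻¹ (H.β (q i) y)) ≠ 0 := by rwa [H.β_inv]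
    have k2 : h (q j) (H.β (q j : Γ)⁻¹ (H.β (q i) y)) ≠ 0 := by
      dsimp only at hz
      rw [← hz, H.β_inv]; exact hy'
    exact k2 (two (fun s => h s (H.β s⁻¹ (H.β (q i) y))) ((e2' _).trans (le1 _)) _ (q i).2 _ (q j).2
      (hq i j hij) k1)
  · rintro _ ⟨y, hy, rfl⟩
    by_contra hB
    have := e2' (H.β (q i) y)
    rw [if_neg hB, Nat.le_zero, Finset.sum_eq_zero_iff] at this
    have := this _ (q i).2
    rw [H.β_inv] at this
    exact hy this

end
end Stmt14

namespace Stmt14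
open Filter
open scoped Pointwise Classical

theorem folner {Γ : Type*} [Group Γ] (a b : Γ → Prop)
    (hK : ∀ S : Finset Γ, ∃ K : Finset Γ, (∀ k ∈ K, a k) ∧ ((S * K).filter b).card < K.card)
    (hT : ∃ T : Finset Γ, ∀ x, ∃ t ∈ T, b (t * x)) (n : ℕ) (S₀ : Finset Γ) (h1 : (1 : Γ) ∈ S₀) :
    ∃ W : Finset Γ, W.Nonempty ∧ (W.filter b).card ≤ (W.filter a).card ∧
      (n + 1) * (S₀ * W).card ≤ (n + 2) * W.card := by
  obtain ⟨T₀, hT₀⟩ := hT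
  let T := insert 1 T₀
  have hT : ∀ x, ∃ t ∈ T, b (t * x) := fun x => by
    obtain ⟨t, ht, h⟩ := hT₀ x
    exact ⟨t, Finset.mem_insert_of_mem ht, h⟩
  have hT1 : (1 : Γ) ∈ T := Finset.mem_insert_self _ _
  choose t ht htb using hT
  have hsyn : ∀ V : Finset Γ, V.card ≤ T.card * ((T * V).filter b).card := by
    intro V
    rw [← Finset.card_product]
    refine Finset.card_le_card_of_injOn (fun x => (t x, t x * x)) ?_ ?_
    · intro x hx
      simp only [Finset.coe_product, mem_prod, Finset.mem_coe, Finset.mem_filter]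
      exact ⟨ht x, Finset.mul_mem_mul (ht x) hx, htb x⟩
    · intro x _ y _ hxy
      simp only [Prod.mk.injEq] at hxy
      rw [hxy.1] at hxy
      exact mul_left_cancel hxy.2
  obtain ⟨m, hm⟩ : ∃ m : ℕ, T.card * (n + 1) ^ m ≤ (n + 2) ^ m := by
    obtain ⟨m, hm⟩ := pow_unbounded_of_one_lt (T.card : ℝ)
      (show (1 : ℝ) < (n + 2) / (n + 1) by rw [one_lt_div (by positivity)]; linarith)
    refine ⟨m, ?_⟩
    rw [div_pow, lt_div_iff₀ (by positivity)] at hm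
    exact_mod_cast hm.le
  obtain ⟨K, hKa, hKb⟩ := hK (T * S₀ ^ m)
  have hK0 : 0 < K.card := lt_of_le_of_lt (Nat.zero_le _) hKb
  have hex : ∃ j < m, (n + 1) * (S₀ ^ (j + 1) * K).card ≤ (n + 2) * (S₀ ^ j * K).card := by
    by_contra! hcon
    have hpow : ∀ j ≤ m, (n + 2) ^ j * K.card ≤ (n + 1) ^ j * (S₀ ^ j * K).card := by
      intro j
      induction j with
      | zero => intro _; simp
      | succ j ih =>
        intro hj
        have h1 := ih (by omega)
        have h2 := hcon j (by omega)
        calc (n + 2) ^ (j + 1) * K.card = (n + 2) * ((n + 2) ^ j * K.card) := by ring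
          _ ≤ (n + 2) * ((n + 1) ^ j * (S₀ ^ j * K).card) := Nat.mul_le_mul_left _ h1
          _ = (n + 1) ^ j * ((n + 2) * (S₀ ^ j * K).card) := by ring
          _ ≤ (n + 1) ^ j * ((n + 1) * (S₀ ^ (j + 1) * K).card) := Nat.mul_le_mul_left _ h2.le
          _ = _ := by ring
    have h2 := hpow m le_rfl
    have h3 := hsyn (S₀ ^ m * K)
    rw [← mul_assoc] at h3
    have hTc : 0 < T.card := Finset.card_pos.2 ⟨1, hT1⟩
    have h4 : (S₀ ^ m * K).card < T.card * K.card :=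
      h3.trans_lt (Nat.mul_lt_mul_of_pos_left hKb hTc)
    have h5 : (n + 1) ^ m * (S₀ ^ m * K).card < (n + 1) ^ m * (T.card * K.card) :=
      Nat.mul_lt_mul_of_pos_left h4 (by positivity)
    have h6 := Nat.mul_le_mul_right K.card hm
    nlinarith
  obtain ⟨j, hj, hjc⟩ := hex
  have hKs : K ⊆ S₀ ^ j * K := by
    intro k hk
    have := Finset.mul_mem_mul (Finset.one_mem_pow h1 (n := j)) hk
    rwa [one_mul] at this
  refine ⟨S₀ ^ j * K, (Finset.card_pos.1 hK0).mono hKs, ?_, ?_⟩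
  · have hsub : S₀ ^ j * K ⊆ T * S₀ ^ m * K := by
      refine Finset.mul_subset_mul_right ?_
      intro x hx
      have := Finset.mul_mem_mul hT1 (Finset.pow_subset_pow_right h1 hj.le hx)
      rwa [one_mul] at this
    calc _ ≤ ((T * S₀ ^ m * K).filter b).card :=
          Finset.card_le_card (Finset.filter_subset_filter _ hsub)
      _ ≤ K.card := hKb.le
      _ ≤ _ := Finset.card_le_card fun k hk => Finset.mem_filter.2 ⟨hKs hk, hKa k hk⟩
  · rwa [pow_succ', mul_assoc] at hjc

theorem lim_measure {Γ I Y : Type*} [TopologicalSpace Y] [CompactSpace Y]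
    [TopologicalSpace.MetrizableSpace Y] [MeasurableSpace Y] [BorelSpace Y]
    (p : Γ → Y) (W : I → Finset Γ) (hW : ∀ i, (W i).Nonempty) (l : Ultrafilter I) :
    ∃ μ : Measure Y, IsProbabilityMeasure μ ∧ ∀ C : Set Y, IsClopen C →
      Tendsto (fun i => (((W i).filter fun w => p w ∈ C).card : ℝ) / (W i).card) l
        (nhds (μ.real C)) := by
  letI := TopologicalSpace.metrizableSpaceMetric Y
  let m : I → Measure Y := fun i => ((W i).card : ℝ≥0∞)⁻¹ • ∑ w ∈ W i, Measure.dirac (p w)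
  have hm : ∀ i C, MeasurableSet C → m i C =
      ((W i).card : ℝ≥0∞)⁻¹ * ((W i).filter fun w => p w ∈ C).card := by
    intro i C hC
    simp only [m, Measure.smul_apply, Measure.finsetSum_apply, smul_eq_mul]
    congr 1
    rw [Finset.card_filter]
    push_cast
    refine Finset.sum_congr rfl fun w _ => ?_
    rw [Measure.dirac_apply' _ hC]
    simp [Set.indicator_apply]
  have hprob : ∀ i, IsProbabilityMeasure (m i) := fun i => ⟨by
    rw [hm i _ MeasurableSet.univ]
    simp only [mem_univ, Finset.filter_true]
    refine ENNReal.inv_mul_cancel ?_ (ENNReal.natCast_ne_top _)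
    exact_mod_cast (Finset.card_pos.2 (hW i)).ne'⟩
  let M : I → ProbabilityMeasure Y := fun i => ⟨m i, hprob i⟩
  obtain ⟨μ, -, hμ⟩ := (isCompact_univ (X := ProbabilityMeasure Y)).ultrafilter_le_nhds
    (l.map M) (by simp)
  have hlim : Tendsto M l (nhds μ) := hμ
  refine ⟨μ, inferInstance, fun C hC => ?_⟩
  have h := ProbabilityMeasure.tendsto_measure_of_isClopen_of_tendsto hlim hC
  have h' := (NNReal.continuous_coe.tendsto _).comp h
  refine Tendsto.congr (fun i => ?_) h'
  change (m i).real C = _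
  rw [measureReal_def, hm i C hC.isOpen.measurableSet]
  simp [div_eq_inv_mul]

section
variable {Γ : Type*} [Group Γ] {α : Γ →* (Cantor ≃ₜ Cantor)} {ι : Type} {e : ι → Γ → ℕ}
  {x₁ : Cantor}

theorem Fam.comparison (H : Fam α e x₁) [Countable ι] : DynComparison H.β := by
  intro A B hA hB hne hμ
  have := H.compact
  obtain ⟨i, hi⟩ := H.rep_clopen hA
  obtain ⟨j, hj⟩ := H.rep_clopen hB
  let f : C(YS e, ℕ) := ⟨fun y => y.1 i, cont_ev i⟩
  let g : C(YS e, ℕ) := ⟨fun y => y.1 j, cont_ev j⟩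
  by_cases hD : Dom (pull f) (pull g)
  · exact H.subeq hi hj hD
  exfalso
  have hF : ∀ x, pull f x = if pt e x ∈ A then 1 else 0 := fun x => hi (pt e x)
  have hG : ∀ x, pull g x = if pt e x ∈ B then 1 else 0 := fun x => hj (pt e x)
  have hK : ∀ S : Finset Γ, ∃ K : Finset Γ, (∀ k ∈ K, pt e k ∈ A) ∧
      ((S * K).filter fun w => pt e w ∈ B).card < K.card := by
    intro S
    unfold Dom at hD
    push Not at hD
    obtain ⟨K, hK⟩ := hD S
    refine ⟨K.filter fun k => pt e k ∈ A, fun k hk => (Finset.mem_filter.1 hk).2, ?_⟩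
    simp only [hF, hG, ← Finset.card_filter] at hK
    refine lt_of_le_of_lt (Finset.card_le_card (Finset.filter_subset_filter _ ?_)) hK
    exact Finset.mul_subset_mul_left (Finset.filter_subset _ _)
  have hT : ∃ T : Finset Γ, ∀ x, ∃ t ∈ T, pt e (t * x) ∈ B := by
    obtain ⟨x, hx⟩ := dense_pt hB.isOpen hne
    have hjB : ∀ x, e j x ≠ 0 ↔ pt e x ∈ B := fun x => by
      change (pt e x).1 j ≠ 0 ↔ _
      rw [hj]; simp
    obtain ⟨T, hT⟩ := H.synd j x ((hjB x).2 hx)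
    refine ⟨T, fun x => ?_⟩
    obtain ⟨t, ht, h⟩ := hT x
    exact ⟨t, ht, (hjB _).1 h⟩
  have hW := fun q : ℕ × Finset Γ => folner _ _ hK hT q.1 (insert 1 q.2) (Finset.mem_insert_self _ _)
  choose W hWne hWab hWS using hW
  letI : MeasurableSpace (YS e) := borel (YS e)
  haveI : BorelSpace (YS e) := ⟨rfl⟩
  let l : Ultrafilter (ℕ × Finset Γ) := Ultrafilter.of atTop
  have hl : (l : Filter (ℕ × Finset Γ)) ≤ atTop := Ultrafilter.of_le _
  obtain ⟨μ, hp, hlim⟩ := lim_measure (pt e) W hWne l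
  have hcard : ∀ q, (0 : ℝ) < (W q).card := fun q => by exact_mod_cast Finset.card_pos.2 (hWne q)
  have hle : μ.real B ≤ μ.real A := by
    refine le_of_tendsto_of_tendsto' (hlim B hB) (hlim A hA) fun q => ?_
    have := hWab q
    gcongr
  have hinv1 : ∀ (γ : Γ) (C : Set (YS e)), IsClopen C → μ.real (H.β γ ⁻¹' C) ≤ μ.real C := by
    intro γ C hC
    have hC' : IsClopen (H.β γ ⁻¹' C) := hC.preimage (H.β γ).continuous
    have h0 : Tendsto (fun q : ℕ × Finset Γ => 1 / ((q.1 : ℝ) + 1)) l (nhds 0) := by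
      refine Tendsto.mono_left ?_ hl
      refine tendsto_one_div_add_atTop_nhds_zero_nat.comp ?_
      rw [← prod_atTop_atTop_eq]
      exact tendsto_fst
    have h1 := (hlim C hC).add h0
    rw [add_zero] at h1
    refine le_of_tendsto_of_tendsto (hlim _ hC') h1 ?_
    have hev : ∀ᶠ q : ℕ × Finset Γ in l, γ ∈ q.2 := by
      refine hl ?_
      filter_upwards [eventually_ge_atTop ((0 : ℕ), ({γ} : Finset Γ))] with q hq
      exact hq.2 (Finset.mem_singleton_self γ)
    filter_upwards [hev] with q hq
    have hc := hcard q
    have key : ((W q).filter fun w => pt e w ∈ H.β γ ⁻¹' C).card + (W q).card ≤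
        ((W q).filter fun w => pt e w ∈ C).card + (insert 1 q.2 * W q).card := by
      have e1 : ((W q).filter fun w => pt e w ∈ H.β γ ⁻¹' C).card ≤
          ((insert 1 q.2 * W q).filter fun w => pt e w ∈ C).card := by
        refine Finset.card_le_card_of_injOn (fun w => γ * w) ?_ ?_
        · intro w hw
          simp only [Finset.coe_filter, mem_ofPred_eq, mem_preimage, H.β_pt] at hw ⊢
          exact ⟨Finset.mul_mem_mul (Finset.mem_insert_of_mem hq) hw.1, hw.2⟩
        · intro x _ y _ h
          exact mul_left_cancel h
      have hs : W q ⊆ insert 1 q.2 * W q := fun w hw => by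
        have := Finset.mul_mem_mul (Finset.mem_insert_self (1 : Γ) q.2) hw
        rwa [one_mul] at this
      have e2 := Finset.card_filter_add_card_filter_not (s := W q) (fun w => pt e w ∈ C)
      have e3 := Finset.card_filter_add_card_filter_not (s := insert 1 q.2 * W q)
        (fun w => pt e w ∈ C)
      have e4 := Finset.card_le_card (Finset.filter_subset_filter (fun w => ¬ pt e w ∈ C) hs)
      omega
    have k1 : (((W q).filter fun w => pt e w ∈ H.β γ ⁻¹' C).card : ℝ) + (W q).card ≤
        ((W q).filter fun w => pt e w ∈ C).card + (insert 1 q.2 * W q).card := by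
      exact_mod_cast key
    have k2 : ((q.1 : ℝ) + 1) * (insert 1 q.2 * W q).card ≤ (q.1 + 2) * (W q).card := by
      exact_mod_cast hWS q
    have hn : (0 : ℝ) < (q.1 : ℝ) + 1 := by positivity
    have k3 : ((insert 1 q.2 * W q).card : ℝ) ≤ (W q).card + 1 / ((q.1 : ℝ) + 1) * (W q).card := by
      rw [← sub_nonneg]
      have : ((W q).card + 1 / ((q.1 : ℝ) + 1) * (W q).card : ℝ) - (insert 1 q.2 * W q).card
        = ((q.1 + 2) * (W q).card - ((q.1 : ℝ) + 1) * (insert 1 q.2 * W q).card) / (q.1 + 1) := by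
        field_simp
        ring
      rw [this]
      exact div_nonneg (by linarith) hn.le
    rw [div_le_iff₀ hc, add_mul, div_mul_cancel₀ _ hc.ne']
    linarith
  have hinv : ∀ (γ : Γ) (C : Set (YS e)), IsClopen C → μ.real (H.β γ ⁻¹' C) = μ.real C := by
    intro γ C hC
    refine le_antisymm (hinv1 γ C hC) ?_
    have := hinv1 γ⁻¹ _ (hC.preimage (H.β γ).continuous)
    have hs : H.β γ⁻¹ ⁻¹' (H.β γ ⁻¹' C) = C := by
      ext y
      simp only [mem_preimage, H.β_inv']
    rwa [hs] at this
  have hmem : μ ∈ invRadon H.β := by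
    refine ⟨hp, ?_, fun γ => ?_⟩
    · letI := TopologicalSpace.metrizableSpaceMetric (YS e)
      infer_instance
    · have hmeas : Measurable (H.β γ) := (H.β γ).continuous.measurable
      haveI : IsProbabilityMeasure (Measure.map (H.β γ) μ) :=
        Measure.isProbabilityMeasure_map hmeas.aemeasurable
      refine ext_of_generate_finite _
        (isTopologicalBasis_isClopen (X := YS e)).borel_eq_generateFrom ?_ ?_ ?_
      · intro s hs t ht _
        exact IsClopen.inter hs ht
      · intro s hs
        have hs' : IsClopen s := hs
        rw [Measure.map_apply hmeas hs'.isOpen.measurableSet]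
        exact (measureReal_eq_measureReal_iff).1 (hinv γ s hs')
      · simp
  have hlt := hμ μ hmem
  have : μ.real A < μ.real B := (ENNReal.toReal_lt_toReal (measure_ne_top _ _) (measure_ne_top _ _)).2 hlt
  linarith

end
end Stmt14

namespace Stmt14
open Filter

section
variable {Γ : Type*} [Group Γ] {α : Γ →* (Cantor ≃ₜ Cantor)} {ι : Type} {e : ι → Γ → ℕ}
  {x₁ : Cantor}

theorem Fam.factor (H : Fam α e x₁) (hmin : IsMinimalAction α) :
    ∃ p : YS e → Cantor, Continuous p ∧ Function.Surjective p ∧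
      ∀ (γ : Γ) (y : YS e), p (H.β γ y) = α γ (p y) := by
  have := H.compact
  choose i hi using H.fac
  let p : YS e → Cantor := fun y n => decide (y.1 (i n) ≠ 0)
  have hp : Continuous p := continuous_pi fun n =>
    (continuous_of_discreteTopology (f := fun k : ℕ => decide (k ≠ 0))).comp (cont_ev (i n))
  have hpt : ∀ x, p (pt e x) = α x x₁ := by
    intro x
    funext n
    change decide (e (i n) x ≠ 0) = _
    rw [hi]
    cases α x x₁ n <;> simp
  have heq : ∀ (γ : Γ) (y : YS e), p (H.β γ y) = α γ (p y) := by
    intro γ y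
    refine eq_of_pt (hp.comp (H.β γ).continuous) ((α γ).continuous.comp hp) (fun x => ?_) y
    change p (H.β γ (pt e x)) = α γ (p (pt e x))
    rw [H.β_pt, hpt, hpt, map_mul]
    rfl
  refine ⟨p, hp, ?_, heq⟩
  rw [← Set.range_eq_univ]
  have hinv : ∀ γ : Γ, ⇑(α γ) '' range p ⊆ range p := by
    rintro γ _ ⟨_, ⟨y, rfl⟩, rfl⟩
    exact ⟨H.β γ y, heq γ y⟩
  rcases hmin (range p) (isCompact_range hp).isClosed hinv with h | h
  · exact ((range_eq_empty_iff.1 h).false (pt e 1)).elim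
  · exact h

theorem Fam.perfect (H : Fam α e x₁) (p : YS e → Cantor) (_hp : Continuous p)
    (hs : Function.Surjective p) : Perfect (Set.univ : Set (YS e)) := by
  have := H.compact
  refine ⟨isClosed_univ, ?_⟩
  rw [preperfect_iff_nhds]
  intro y _ U hU
  by_contra! hcon
  have hopen : IsOpen ({y} : Set (YS e)) := by
    have : U = {y} := by
      ext z
      constructor
      · intro hz
        exact hcon z ⟨hz, mem_univ _⟩
      · rintro rfl
        exact mem_of_mem_nhds hU
    rw [this] at hU
    exact isOpen_singleton_iff_nhds_eq_pure y |>.2 (le_antisymm (by simpa using hU) (pure_le_nhds y))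
  have horb : ∀ γ, IsOpen ({H.β γ y} : Set (YS e)) := fun γ => by
    have := (H.β γ).isOpenMap _ hopen
    rwa [image_singleton] at this
  have hO : IsOpen (range fun γ => H.β γ y) := by
    have : (range fun γ => H.β γ y) = ⋃ γ, {H.β γ y} := by
      ext z
      simp [eq_comm]
    rw [this]
    exact isOpen_iUnion horb
  have huniv : (range fun γ => H.β γ y) = univ := by
    have hinv : ∀ γ : Γ, ⇑(H.β γ) '' (range fun γ => H.β γ y)ᶜ ⊆ (range fun γ => H.β γ y)ᶜ := by
      rintro γ _ ⟨z, hz, rfl⟩ ⟨δ, hδ⟩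
      refine hz ⟨γ⁻¹ * δ, ?_⟩
      dsimp only at hδ ⊢
      rw [H.β_mul, hδ, H.β_inv]
    rcases H.minimal_β (range fun γ => H.β γ y)ᶜ hO.isClosed_compl hinv with h | h
    · exact compl_empty_iff.1 h
    · exact absurd (mem_univ (H.β 1 y)) (by rw [← h]; exact fun h => h (mem_range_self _))
  have hd : DiscreteTopology (YS e) := by
    rw [discreteTopology_iff_isOpen_singleton]
    intro z
    obtain ⟨γ, rfl⟩ : z ∈ range fun γ => H.β γ y := huniv ▸ mem_univ z
    exact horb γ
  have hfin : Finite (YS e) := finite_of_compact_of_discrete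
  have : Finite Cantor := Finite.of_surjective p hs
  exact not_finite Cantor

end
end Stmt14

/-- Every minimal action `α` of a countable group `Γ` on the Cantor space
is a factor of a free minimal action `β` of `Γ` on a (nonempty compact metrizable
`0`-dimensional perfect) space `Y` whose clopen type semigroup is unperforated and partially
ordered; in particular `β` has dynamical comparison. -/
theorem stmt14 {Γ : Type*} [Group Γ] [Countable Γ]
    (α : Γ →* (Cantor ≃ₜ Cantor)) (hmin : IsMinimalAction α) :
    ∃ (Y : Type) (tY : TopologicalSpace Y),
      letI := tY
      (Nonempty Y ∧ CompactSpace Y ∧ TopologicalSpace.MetrizableSpace Y ∧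
        TotallyDisconnectedSpace Y ∧ Perfect (Set.univ : Set Y)) ∧
      ∃ β : Γ →* (Y ≃ₜ Y),
        (∀ (γ : Γ) (y : Y), β γ y = y → γ = 1) ∧
        IsMinimalAction β ∧
        IsUnperforated β ∧ TleAntisymm β ∧ DynComparison β ∧
        ∃ p : Y → Cantor, Continuous p ∧ Function.Surjective p ∧
          ∀ (γ : Γ) (y : Y), p (β γ y) = α γ (p y) := by
  obtain ⟨ι, _, e, x₁, H⟩ := Stmt14.exists_fam α
  have hcp := H.compact
  obtain ⟨p, hp1, hp2, hp3⟩ := H.factor hmin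
  refine ⟨Stmt14.YS e, inferInstance, ⟨⟨Stmt14.pt e 1⟩, hcp, inferInstance, inferInstance,
    H.perfect p hp1 hp2⟩, H.β, H.free_β, H.minimal_β, H.unperf, H.antisymm, H.comparison,
    p, hp1, hp2, hp3⟩
end
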